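/- arXiv:2511.15226 — 2 statements merged into one kernel-verified Lean document; each statement's English description precedes it below -/
import Mathlib

section
/- Every signed 2-edge-connected simple cubic graph (G, σ) on at least 10 vertices satisfies F(G, σ) ≤ (2/9)·e(G), where e(G) is the number of edges. -/
open scoped Classical

/-- The Boolean indicating whether an edge crosses the vertex set `X`. -/
noncomputable def sgnCross {V : Type*} (X : Set V) : Sym2 V → Bool :=
  Sym2.lift ⟨fun a b => xor (decide (a ∈ X)) (decide (b ∈ X)),
    fun a b => Bool.xor_comm _ _⟩

/-- The signature obtained from `σ` by switching at the edge-cut `[X, Xᶜ]`: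
the signs of all edges crossing `X` are flipped.  (`true` = negative.) -/
noncomputable def sgnSwitch {V : Type*} (σ : Sym2 V → Bool) (X : Set V) : Sym2 V → Bool :=
  fun e => xor (σ e) (sgnCross X e)

/-- The number of negative edges of the signed graph `(G, σ)`. -/
noncomputable def negNum {V : Type*} (G : SimpleGraph V) (σ : Sym2 V → Bool) : ℕ :=
  {e | e ∈ G.edgeSet ∧ σ e = true}.ncard

/-- The frustration index of `(G, σ)`: the minimum number of negative edges over
all switching-equivalent signatures. -/
noncomputable def frust {V : Type*} (G : SimpleGraph V) (σ : Sym2 V → Bool) : ℕ :=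
  ⨅ X : Set V, negNum G (sgnSwitch σ X)

/-- The number of edges of `G` in the edge-cut `[X, Xᶜ]`. -/
noncomputable def cutSize {V : Type*} (G : SimpleGraph V) (X : Set V) : ℕ :=
  {e | e ∈ G.edgeSet ∧ sgnCross X e = true}.ncard

/-- A graph is 2-edge-connected if every edge-cut has at least 2 edges. -/
def TwoEdgeConn {V : Type*} (G : SimpleGraph V) : Prop :=
  ∀ X : Set V, X.Nonempty → Xᶜ.Nonempty → 2 ≤ cutSize G X

namespace SignedCubic

section Tools

variable {V W : Type*}

/-- The subgraph of `G` spanned by the edges with both ends in `X`. -/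
def within (G : SimpleGraph V) (X : Set V) : SimpleGraph V where
  Adj a b := G.Adj a b ∧ a ∈ X ∧ b ∈ X
  symm := ⟨fun _ _ h => ⟨h.1.symm, h.2.2, h.2.1⟩⟩
  loopless := ⟨fun _ h => h.1.ne rfl⟩

/-- `G` is connected on the vertex set `X`. -/
def ConnOn (G : SimpleGraph V) (X : Set V) : Prop :=
  ∀ a ∈ X, ∀ b ∈ X, (within G X).Reachable a b

/-- The graph of the edges of `H` that lie on a cycle. -/
def cyclicPart (H : SimpleGraph V) : SimpleGraph V where
  Adj a b := H.Adj a b ∧ (H.deleteEdges {s(a, b)}).Reachable a b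
  symm := ⟨fun a b h => ⟨h.1.symm, by rw [Sym2.eq_swap]; exact h.2.symm⟩⟩
  loopless := ⟨fun _ h => h.1.ne rfl⟩

/-- The graph of the bridges of `H`. -/
def bridgePart (H : SimpleGraph V) : SimpleGraph V where
  Adj a b := H.Adj a b ∧ ¬ (H.deleteEdges {s(a, b)}).Reachable a b
  symm := ⟨fun a b h => ⟨h.1.symm, by rw [Sym2.eq_swap]; exact fun h' => h.2 h'.symm⟩⟩
  loopless := ⟨fun _ h => h.1.ne rfl⟩

/-- `v` lies on a cycle of `H`. -/
def OnCycle (H : SimpleGraph V) (v : V) : Prop := ∃ w, (cyclicPart H).Adj v w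

lemma within_le (G : SimpleGraph V) (X : Set V) : within G X ≤ G := fun _ _ h => h.1

lemma within_mono {G G' : SimpleGraph V} {X Y : Set V} (hG : G ≤ G') (h : X ⊆ Y) :
    within G X ≤ within G' Y := fun _ _ h' => ⟨hG h'.1, h h'.2.1, h h'.2.2⟩

lemma adj_cases {H : SimpleGraph V} {a b : V} (h : H.Adj a b) :
    (cyclicPart H).Adj a b ∨ (bridgePart H).Adj a b := by
  by_cases h' : (H.deleteEdges {s(a, b)}).Reachable a b
  · exact .inl ⟨h, h'⟩
  · exact .inr ⟨h, h'⟩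

lemma reach_inv {H : SimpleGraph V} (P : V → Prop)
    (hP : ∀ v w, H.Adj v w → P v → P w) {a b : V} (h : H.Reachable a b) (ha : P a) : P b := by
  obtain ⟨p⟩ := h
  induction p with
  | nil => exact ha
  | cons h p ih => exact ih (hP _ _ h ha)

lemma reach_map {H : SimpleGraph V} {H' : SimpleGraph W} (f : V → W) (P : V → Prop)
    (hP : ∀ v w, H.Adj v w → P v → P w)
    (hf : ∀ v w, H.Adj v w → P v → P w → H'.Reachable (f v) (f w)) {a b : V}
    (h : H.Reachable a b) (ha : P a) : H'.Reachable (f a) (f b) := by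
  obtain ⟨p⟩ := h
  induction p with
  | nil => exact .rfl
  | cons h p ih => exact (hf _ _ h ha (hP _ _ h ha)).trans (ih (hP _ _ h ha))

lemma reach_sub {H H' : SimpleGraph V} (P : V → Prop)
    (hP : ∀ v w, H.Adj v w → P v → P w)
    (hf : ∀ v w, H.Adj v w → P v → P w → H'.Adj v w) {a b : V}
    (h : H.Reachable a b) (ha : P a) : H'.Reachable a b :=
  reach_map id P hP (fun v w h1 h2 h3 => (hf v w h1 h2 h3).reachable) h ha

lemma exists_adj_of_reachable_ne {H : SimpleGraph V} {a b : V} (h : H.Reachable a b)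
    (hne : a ≠ b) : ∃ c, H.Adj a c := by
  obtain ⟨p⟩ := h
  cases p with
  | nil => exact absurd rfl hne
  | cons h p => exact ⟨_, h⟩

lemma first_entry {H : SimpleGraph V} {S : Set V} {x y : V} (h : H.Reachable x y)
    (hx : x ∉ S) (hy : y ∈ S) :
    ∃ p q, H.Adj p q ∧ p ∉ S ∧ q ∈ S ∧ (within H Sᶜ).Reachable x p := by
  obtain ⟨w⟩ := h
  induction w with
  | nil => exact absurd hy hx
  | @cons u v w h p ih =>
    by_cases hv : v ∈ S
    · exact ⟨u, v, h, hx, hv, .rfl⟩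
    · obtain ⟨p, q, h1, h2, h3, h4⟩ := ih hv hy
      refine ⟨p, q, h1, h2, h3, ?_⟩
      have : (within H Sᶜ).Adj u v := ⟨h, hx, hv⟩
      exact this.reachable.trans h4

lemma cyclicPart_adj_iff_cycle {H : SimpleGraph V} {a b : V} :
    (cyclicPart H).Adj a b ↔ ∃ (u : V) (p : H.Walk u u), p.IsCycle ∧ s(a, b) ∈ p.edges :=
  SimpleGraph.adj_and_reachable_delete_edges_iff_exists_cycle

/-- The cyclic part of a graph has no bridges. -/
lemma cyclicPart_reachable {H : SimpleGraph V} {a b : V} (h : (cyclicPart H).Adj a b) :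
    ((cyclicPart H).deleteEdges {s(a, b)}).Reachable a b := by
  obtain ⟨u, p, hp, he⟩ := cyclicPart_adj_iff_cycle.1 h
  have hsub : ∀ e ∈ p.edges, e ∈ (cyclicPart H).edgeSet := by
    intro e he
    induction e with
    | _ x y => exact cyclicPart_adj_iff_cycle.2 ⟨u, p, hp, he⟩
  have := (cyclicPart_adj_iff_cycle (H := cyclicPart H)).2
    ⟨u, p.transfer _ hsub, hp.transfer hsub, by simpa using he⟩
  exact this.2

lemma delete_adj {H : SimpleGraph V} {a b x y : V} :
    (H.deleteEdges {s(a, b)}).Adj x y ↔ H.Adj x y ∧ s(x, y) ≠ s(a, b) := by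
  simp [SimpleGraph.deleteEdges_adj]

lemma cyclicPart_mono {H H' : SimpleGraph V} (h : H ≤ H') : cyclicPart H ≤ cyclicPart H' := by
  intro a b hab
  refine ⟨h hab.1, hab.2.mono ?_⟩
  intro x y hxy
  rw [delete_adj] at hxy ⊢
  exact ⟨h hxy.1, hxy.2⟩

lemma exists_second {H : SimpleGraph V} {a b : V} (h : (cyclicPart H).Adj a b) :
    ∃ c, c ≠ b ∧ (cyclicPart H).Adj a c := by
  obtain ⟨c, hc⟩ := exists_adj_of_reachable_ne (cyclicPart_reachable h) h.ne
  rw [delete_adj] at hc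
  exact ⟨c, fun hcb => hc.2 (by rw [hcb]), hc.1⟩

lemma reach_avoid {H : SimpleGraph V} {b c : V} (h : H.Adj b c)
    (hr : (H.deleteEdges {s(b, c)}).Reachable b c) :
    ∃ d, d ≠ c ∧ H.Adj b d ∧ (within H {b}ᶜ).Reachable c d := by
  obtain ⟨p, q, h1, h2, h3, h4⟩ := first_entry (S := {b}) hr.symm h.ne.symm rfl
  obtain rfl : q = b := h3
  rw [delete_adj] at h1
  refine ⟨p, ?_, h1.1.symm, h4.mono (within_mono (SimpleGraph.deleteEdges_le _) le_rfl)⟩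
  rintro rfl
  exact h1.2 Sym2.eq_swap

lemma ConnOn.union {G : SimpleGraph V} {X Y : Set V} (hX : ConnOn G X) (hY : ConnOn G Y)
    {x y : V} (hx : x ∈ X) (hy : y ∈ Y) (hxy : G.Adj x y) : ConnOn G (X ∪ Y) := by
  have key : ∀ a ∈ X ∪ Y, (within G (X ∪ Y)).Reachable x a := by
    rintro a (ha | ha)
    · exact (hX x hx a ha).mono (within_mono le_rfl Set.subset_union_left)
    · have : (within G (X ∪ Y)).Adj x y := ⟨hxy, .inl hx, .inr hy⟩
      exact this.reachable.trans
        ((hY y hy a ha).mono (within_mono le_rfl Set.subset_union_right))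
  exact fun a ha b hb => (key a ha).symm.trans (key b hb)

lemma connOn_singleton (G : SimpleGraph V) (x : V) : ConnOn G {x} := by
  rintro a rfl b rfl
  exact .rfl

lemma ConnOn.insert {G : SimpleGraph V} {X : Set V} (hX : ConnOn G X) {x u : V}
    (hx : x ∈ X) (hux : G.Adj u x) : ConnOn G (insert u X) := by
  rw [← Set.union_singleton]
  exact hX.union (connOn_singleton G u) hx rfl hux.symm

lemma ConnOn.diff_leaf {G : SimpleGraph V} {X : Set V} (hX : ConnOn G X) {y p : V}
    (h : ∀ w ∈ X, G.Adj y w → w = p) : ConnOn G (X \ {y}) := by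
  intro a ha b hb
  have := reach_map (H' := within G (X \ {y})) (fun v => if v = y then p else v)
    (fun _ => True) (fun _ _ _ _ => trivial) ?_ (hX a ha.1 b hb.1) trivial
  · have ha' : a ≠ y := ha.2
    have hb' : b ≠ y := hb.2
    simpa only [if_neg ha', if_neg hb'] using this
  · rintro v w ⟨h1, h2, h3⟩ - -
    by_cases hv : v = y
    · have hw : w = p := h w h3 (hv ▸ h1)
      have hw' : w ≠ y := fun h' => h1.ne (hv.trans h'.symm)
      simp only [if_pos hv, if_neg hw']
      rw [hw]
    · by_cases hw : w = y
      · have : v = p := h v h2 (hw ▸ h1.symm)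
        simp only [if_pos hw, if_neg hv]
        rw [this]
      · simp only [if_neg hv, if_neg hw]
        have : (within G (X \ {y})).Adj v w := ⟨h1, ⟨h2, hv⟩, ⟨h3, hw⟩⟩
        exact this.reachable

lemma within_reachable_of_notMem_support {H : SimpleGraph V} {a b y : V} (p : H.Walk a b)
    (h : y ∉ p.support) : (within H {y}ᶜ).Reachable a b := by
  induction p with
  | nil => exact .rfl
  | @cons a c b hac p ih =>
    rw [SimpleGraph.Walk.support_cons, List.mem_cons, not_or] at h
    have hc : c ≠ y := fun hc => h.2 (hc ▸ p.start_mem_support)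
    have : (within H {y}ᶜ).Adj a c := ⟨hac, fun h' => h.1 h'.symm, hc⟩
    exact this.reachable.trans (ih h.2)

lemma avoid_of_dist_le {H : SimpleGraph V} {b w y : V} (hw : H.Reachable b w)
    (hd : H.dist b w ≤ H.dist b y) (hne : w ≠ y) : (within H {y}ᶜ).Reachable b w := by
  obtain ⟨p, hp⟩ := hw.exists_walk_length_eq_dist
  refine within_reachable_of_notMem_support p fun hy => ?_
  have h1 := SimpleGraph.dist_le (p.takeUntil y hy)
  have h2 := congrArg SimpleGraph.Walk.length (p.take_spec hy)
  rw [SimpleGraph.Walk.length_append] at h2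
  have h3 : (p.dropUntil y hy).length ≠ 0 := fun h =>
    hne (SimpleGraph.Walk.eq_of_length_eq_zero h).symm
  omega

end Tools

section Local

variable {V : Type*}

/-- The part of `G` outside `J`, with the vertices of `J` kept as isolated vertices. -/
def core (G : SimpleGraph V) (J : Finset V) : SimpleGraph V := within G {v | v ∉ J}

/-- `J` is an independent set whose removal leaves a connected graph. -/
structure IsNonseparating (G : SimpleGraph V) (J : Finset V) : Prop where
  indep : ∀ a ∈ J, ∀ b ∈ J, ¬ G.Adj a b
  conn : ConnOn G {v | v ∉ J}

/-- The number of vertices on cycles of `G - J`. -/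
noncomputable def cycNum (G : SimpleGraph V) (J : Finset V) : ℕ :=
  {v | OnCycle (core G J) v}.ncard

/-- `G` is cubic and 2-edge-connected. -/
structure IsCubicTwoEdgeConn (G : SimpleGraph V) : Prop where
  three : ∀ v, ∃ a b c, a ≠ b ∧ a ≠ c ∧ b ≠ c ∧ ∀ w, G.Adj v w ↔ w = a ∨ w = b ∨ w = c
  cut : ∀ X : Set V, X.Nonempty → Xᶜ.Nonempty → ∃ a b c d, G.Adj a b ∧ a ∈ X ∧ b ∉ X ∧
    G.Adj c d ∧ c ∈ X ∧ d ∉ X ∧ (a ≠ c ∨ b ≠ d)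

/-- `J` is a nonseparating independent set of maximum size. -/
structure IsMaximum (G : SimpleGraph V) (J : Finset V) : Prop extends
    IsCubicTwoEdgeConn G, IsNonseparating G J where
  max : ∀ J', IsNonseparating G J' → J'.card ≤ J.card

/-- `J` is a maximum nonseparating independent set for which `G - J` has the largest number of
vertices on cycles. -/
structure IsOptimal (G : SimpleGraph V) (J : Finset V) : Prop extends IsMaximum G J where
  max_cyc : ∀ J', IsNonseparating G J' → J'.card = J.card → cycNum G J' ≤ cycNum G J

/-- The cyclic part of `G - J`. -/
abbrev cycG (G : SimpleGraph V) (J : Finset V) : SimpleGraph V := cyclicPart (core G J)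

/-- The bridges of `G - J`. -/
abbrev brG (G : SimpleGraph V) (J : Finset V) : SimpleGraph V := bridgePart (core G J)

/-- `v` lies on a cycle of `G - J`. -/
abbrev Cyc (G : SimpleGraph V) (J : Finset V) (v : V) : Prop := OnCycle (core G J) v

/-- The vertices joined to `b` by bridges of `G - J`. -/
def branch (G : SimpleGraph V) (J : Finset V) (b : V) : Set V := {x | (brG G J).Reachable b x}

/-- The branch at `b` without `b` itself. -/
def stem (G : SimpleGraph V) (J : Finset V) (b : V) : Set V := branch G J b \ {b}

/-- `b` is on a cycle of `G - J` and is the only such vertex of its branch. -/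
def Light (G : SimpleGraph V) (J : Finset V) (b : V) : Prop :=
  Cyc G J b ∧ ∀ w, (brG G J).Reachable b w → Cyc G J w → w = b

variable {G : SimpleGraph V} {J : Finset V} {a b c d u v w x y p q : V}

lemma core_adj : (core G J).Adj a b ↔ G.Adj a b ∧ a ∉ J ∧ b ∉ J := Iff.rfl

lemma cyc_left (h : (cycG G J).Adj a b) : Cyc G J a := ⟨b, h⟩

lemma cyc_right (h : (cycG G J).Adj a b) : Cyc G J b := ⟨a, h.symm⟩

lemma Cyc.notMem (h : Cyc G J a) : a ∉ J := by
  obtain ⟨w, h⟩ := h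
  exact h.1.2.1

lemma Cyc.of_reachable (h : Cyc G J a) (hab : (cycG G J).Reachable a b) : Cyc G J b :=
  reach_inv (fun v => Cyc G J v) (fun _ _ h1 _ => cyc_right h1) hab h

lemma IsCubicTwoEdgeConn.fourth (hG : IsCubicTwoEdgeConn G) (ha : G.Adj v a) (hb : G.Adj v b)
    (hc : G.Adj v c) (hab : a ≠ b) (hac : a ≠ c) (hbc : b ≠ c) (hd : G.Adj v d) :
    d = a ∨ d = b ∨ d = c := by
  obtain ⟨x, y, z, -, -, -, h⟩ := hG.three v
  rw [h] at ha hb hc hd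
  grind

lemma IsCubicTwoEdgeConn.third (hG : IsCubicTwoEdgeConn G) (ha : G.Adj v a) (hb : G.Adj v b)
    (hab : a ≠ b) : ∃ c, G.Adj v c ∧ a ≠ c ∧ b ≠ c := by
  obtain ⟨x, y, z, h1, h2, h3, h⟩ := hG.three v
  simp only [h] at ha hb ⊢
  rcases ha with rfl | rfl | rfl <;> rcases hb with rfl | rfl | rfl <;> simp_all [eq_comm]

lemma IsCubicTwoEdgeConn.others (hG : IsCubicTwoEdgeConn G) (ha : G.Adj v a) :
    ∃ b c, G.Adj v b ∧ G.Adj v c ∧ a ≠ b ∧ a ≠ c ∧ b ≠ c := by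
  obtain ⟨x, y, z, h1, h2, h3, h⟩ := hG.three v
  simp only [h] at ha ⊢
  rcases ha with rfl | rfl | rfl
  · exact ⟨y, z, by simp, by simp, h1, h2, h3⟩
  · exact ⟨x, z, by simp, by simp, h1.symm, h3, h2⟩
  · exact ⟨x, y, by simp, by simp, h2.symm, h3.symm, h1⟩

lemma indep_insert {v : V} {A : Finset V} (hA : ∀ a ∈ A, ∀ b ∈ A, ¬ G.Adj a b)
    (hv : ∀ a ∈ A, ¬ G.Adj v a) : ∀ a ∈ insert v A, ∀ b ∈ insert v A, ¬ G.Adj a b := by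
  intro x hx y hy hxy
  rw [Finset.mem_insert] at hx hy
  rcases hx with rfl | hx <;> rcases hy with rfl | hy
  · exact hxy.ne rfl
  · exact hv _ hy hxy
  · exact hv _ hx hxy.symm
  · exact hA _ hx _ hy hxy

/-- A vertex outside `J` has at most two incident edges on cycles of `G - J`. -/
lemma IsMaximum.not_three (hO : IsMaximum G J) (ha : (cycG G J).Adj v a)
    (hb : (cycG G J).Adj v b) (hc : (cycG G J).Adj v c) (hab : a ≠ b) (hac : a ≠ c)
    (hbc : b ≠ c) : False := by
  have hv : v ∉ J := ha.1.2.1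
  have h4 : ∀ d, G.Adj v d → d = a ∨ d = b ∨ d = c := fun d hd =>
    hO.fourth ha.1.1 hb.1.1 hc.1.1 hab hac hbc hd
  have hns : IsNonseparating G (insert v J) := by
    have hvJ : ∀ d ∈ J, ¬ G.Adj v d := by
      intro d hd hvd
      rcases h4 d hvd with rfl | rfl | rfl
      · exact ha.1.2.2 hd
      · exact hb.1.2.2 hd
      · exact hc.1.2.2 hd
    refine ⟨indep_insert hO.indep hvJ, ?_⟩
    · have hle : within (core G J) {v}ᶜ ≤ within G {x | x ∉ insert v J} := by
        intro x y h
        refine ⟨h.1.1, ?_, ?_⟩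
        · have h1 := h.2.1
          have h2 := h.1.2.1
          simp_all
        · have h1 := h.2.2
          have h2 := h.1.2.2
          simp_all
      set K := within G {x | x ∉ insert v J}
      have conn2 : ∀ x, (cycG G J).Adj v x →
          ∃ z, z ≠ x ∧ (z = a ∨ z = b ∨ z = c) ∧ K.Reachable x z := by
        intro x hx
        obtain ⟨z, h1, h2, h3⟩ := reach_avoid hx.1 hx.2
        exact ⟨z, h1, h4 z h2.1, h3.mono hle⟩
      have habc : K.Reachable a b ∧ K.Reachable a c := by
        obtain ⟨x, hx1, hx2, hx3⟩ := conn2 a ha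
        obtain ⟨y, hy1, hy2, hy3⟩ := conn2 b hb
        obtain ⟨z, hz1, hz2, hz3⟩ := conn2 c hc
        rcases hx2 with rfl | rfl | rfl
        · exact absurd rfl hx1
        · refine ⟨hx3, ?_⟩
          rcases hz2 with rfl | rfl | rfl
          · exact hz3.symm
          · exact hx3.trans hz3.symm
          · exact absurd rfl hz1
        · refine ⟨?_, hx3⟩
          rcases hy2 with rfl | rfl | rfl
          · exact hy3.symm
          · exact absurd rfl hy1
          · exact hx3.trans hy3.symm
      have key : ∀ x, x ∉ insert v J → K.Reachable x a := by
        intro x hx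
        rw [Finset.mem_insert, not_or] at hx
        obtain ⟨p, q, h1, h2, h3, h5⟩ := first_entry (S := {v}) (hO.conn x hx.2 v hv) hx.1 rfl
        obtain rfl : q = v := h3
        have hp := h5.mono hle
        rcases h4 p h1.1.symm with rfl | rfl | rfl
        · exact hp
        · exact hp.trans habc.1.symm
        · exact hp.trans habc.2.symm
      exact fun x hx y hy => (key x hx).trans (key y hy).symm
  have := hO.max _ hns
  rw [Finset.card_insert_of_notMem hv] at this
  omega

lemma IsOptimal.two (hO : IsOptimal G J) (hb : Cyc G J b) :
    ∃ c d, c ≠ d ∧ (cycG G J).Adj b c ∧ (cycG G J).Adj b d ∧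
      ∀ x, (cycG G J).Adj b x → x = c ∨ x = d := by
  obtain ⟨c, hc⟩ := hb
  obtain ⟨d, hdc, hd⟩ := exists_second hc
  refine ⟨c, d, hdc.symm, hc, hd, fun x hx => ?_⟩
  by_contra! h
  exact hO.not_three hc hd hx hdc.symm h.1.symm h.2.symm

/-- The two cyclic neighbours of `b` are joined on the cycle through `b`, avoiding `b`. -/
lemma around (hcd : c ≠ d) (hc : (cycG G J).Adj b c)
    (h : ∀ x, (cycG G J).Adj b x → x = c ∨ x = d) :
    (within (cycG G J) {b}ᶜ).Reachable c d := by
  obtain ⟨z, h1, h2, h3⟩ := reach_avoid hc (cyclicPart_reachable hc)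
  rcases h z h2 with rfl | rfl
  · exact absurd rfl h1
  · exact h3

lemma mem_branch_self : b ∈ branch G J b := SimpleGraph.Reachable.rfl

lemma branch_notMem (hb : b ∉ J) (hx : x ∈ branch G J b) : x ∉ J :=
  reach_inv (H := brG G J) (fun v => v ∉ J) (fun _ _ h _ => h.1.2.2) hx hb

lemma Light.notMem (hb : Light G J b) : b ∉ J := hb.1.notMem

lemma Light.branch_notMem (hb : Light G J b) (hx : x ∈ branch G J b) : x ∉ J :=
  SignedCubic.branch_notMem hb.notMem hx

lemma Light.eq_of_cyc (hb : Light G J b) (hx : x ∈ branch G J b) (hc : Cyc G J x) : x = b :=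
  hb.2 x hx hc

lemma Light.stem_notMem (hb : Light G J b) (hx : x ∈ stem G J b) : x ∉ J :=
  hb.branch_notMem hx.1

lemma mem_branch_cases (hx : x ∈ branch G J b) : x = b ∨ x ∈ stem G J b := by
  by_cases h : x = b
  · exact .inl h
  · exact .inr ⟨hx, h⟩

lemma Light.exit (hb : Light G J b) (hv : v ∈ branch G J b) (hw : w ∉ branch G J b)
    (hwJ : w ∉ J) (h : G.Adj v w) : v = b ∧ (cycG G J).Adj b w := by
  rcases adj_cases (core_adj.2 ⟨h, hb.branch_notMem hv, hwJ⟩) with h' | h'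
  · obtain rfl := hb.eq_of_cyc hv (cyc_left h')
    exact ⟨rfl, h'⟩
  · exact absurd (SimpleGraph.Reachable.trans hv h'.reachable) hw

lemma Light.stem_closed (hb : Light G J b) (hv : v ∈ stem G J b) (hwJ : w ∉ J)
    (h : G.Adj v w) : w ∈ branch G J b := by
  by_contra hw
  exact hv.2 (hb.exit hv.1 hw hwJ h).1

lemma Light.disjoint (hb : Light G J b) (hc : Light G J c) (hbc : b ≠ c)
    (hx : x ∈ branch G J b) : x ∉ branch G J c := by
  intro hx'
  exact hbc (hb.2 c (SimpleGraph.Reachable.trans hx hx'.symm) hc.1).symm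

lemma Light.not_adj (hb : Light G J b) (hc : Light G J c) (hbc : ¬ (cycG G J).Reachable b c)
    (hx : x ∈ branch G J b) (hy : y ∈ branch G J c) : ¬ G.Adj x y := by
  intro h
  have hne : c ≠ b := fun h => hbc (h ▸ .rfl)
  obtain ⟨rfl, h1⟩ := hb.exit hx (hc.disjoint hb hne hy) (hc.branch_notMem hy) h
  obtain rfl := hc.eq_of_cyc hy (cyc_right h1)
  exact hbc h1.reachable

lemma ne_of_not_reach (hbc : ¬ (cycG G J).Reachable b c) : b ≠ c := fun h => hbc (h ▸ .rfl)

lemma IsOptimal.connOn_diff_branch (hO : IsOptimal G J) {X : Set V} (hXJ : ∀ x ∈ X, x ∉ J)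
    (hX : ConnOn G X) (hb : Light G J b) (hC : ∀ x, (cycG G J).Reachable b x → x ∈ X) :
    ConnOn G (X \ branch G J b) := by
  obtain ⟨c, d, hcd, hc, hd, hcd'⟩ := hO.two hb.1
  have hout : ∀ x, Cyc G J x → x ≠ b → x ∉ branch G J b := fun x h1 h2 h3 =>
    h2 (hb.eq_of_cyc h3 h1)
  have hcdr : (within G (X \ branch G J b)).Reachable c d := by
    refine reach_sub (fun x => (cycG G J).Reachable b x) ?_ ?_ (around hcd hc hcd') hc.reachable
    · intro x y h hx
      exact hx.trans h.1.reachable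
    · intro x y h hx hy
      exact ⟨h.1.1.1, ⟨hC x hx, hout x (cyc_left h.1) h.2.1⟩,
        ⟨hC y hy, hout y (cyc_right h.1) h.2.2⟩⟩
  have hcr : ∀ x, (cycG G J).Adj b x → (within G (X \ branch G J b)).Reachable c x := by
    intro x hx
    rcases hcd' x hx with rfl | rfl
    · exact .rfl
    · exact hcdr
  intro x hx y hy
  have := reach_map (H' := within G (X \ branch G J b))
    (fun v => if v ∈ branch G J b then c else v)
    (fun _ => True) (fun _ _ _ _ => trivial) ?_ (hX x hx.1 y hy.1) trivial
  · simpa only [if_neg hx.2, if_neg hy.2] using this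
  · rintro v w ⟨h1, h2, h3⟩ - -
    by_cases hv : v ∈ branch G J b <;> by_cases hw : w ∈ branch G J b
    · simp only [if_pos hv, if_pos hw]
      exact .rfl
    · simp only [if_pos hv, if_neg hw]
      exact hcr w (hb.exit hv hw (hXJ w h3) h1).2
    · simp only [if_pos hw, if_neg hv]
      exact (hcr v (hb.exit hw hv (hXJ v h2) h1.symm).2).symm
    · simp only [if_neg hv, if_neg hw]
      have : (within G (X \ branch G J b)).Adj v w := ⟨h1, ⟨h2, hv⟩, ⟨h3, hw⟩⟩
      exact this.reachable

lemma IsOptimal.connOn_diff_one (hO : IsOptimal G J) (hb : Light G J b) :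
    ConnOn G ({v | v ∉ J} \ branch G J b) :=
  hO.connOn_diff_branch (fun _ h => h) hO.conn hb fun _ hx => (hb.1.of_reachable hx).notMem

lemma IsOptimal.connOn_diff_two (hO : IsOptimal G J) (hb : Light G J b) (hc : Light G J c)
    (hbc : ¬ (cycG G J).Reachable b c) :
    ConnOn G (({v | v ∉ J} \ branch G J b) \ branch G J c) := by
  refine hO.connOn_diff_branch (fun _ h => h.1) (hO.connOn_diff_one hb) hc fun x hx => ?_
  have hx' := hc.1.of_reachable hx
  refine ⟨hx'.notMem, fun hxb => ?_⟩
  obtain rfl := hb.eq_of_cyc hxb hx'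
  exact hbc hx.symm

lemma connOn_branch : ConnOn G (branch G J b) := by
  have key : ∀ x ∈ branch G J b, (within G (branch G J b)).Reachable b x := by
    intro x hx
    refine reach_sub (fun v => v ∈ branch G J b) ?_ ?_ hx mem_branch_self
    · intro v w h hv
      exact SimpleGraph.Reachable.trans hv h.reachable
    · intro v w h hv hw
      exact ⟨h.1.1, hv, hw⟩
  exact fun x hx y hy => (key x hx).symm.trans (key y hy)

lemma IsOptimal.connOn_stem (hO : IsOptimal G J) (hb : Light G J b) :
    ConnOn G (stem G J b) := by
  obtain ⟨c, d, hcd, hc, hd, -⟩ := hO.two hb.1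
  have hcB : c ∉ branch G J b := fun h => hc.ne (hb.eq_of_cyc h (cyc_right hc)).symm
  have hdB : d ∉ branch G J b := fun h => hd.ne (hb.eq_of_cyc h (cyc_right hd)).symm
  have : ∃ p, ∀ w ∈ branch G J b, G.Adj b w → w = p := by
    by_cases h : ∃ p, p ∈ branch G J b ∧ G.Adj b p
    · obtain ⟨p, hp, hbp⟩ := h
      refine ⟨p, fun w hw hbw => ?_⟩
      rcases hO.fourth hc.1.1 hd.1.1 hbp hcd (fun h => hcB (h ▸ hp)) (fun h => hdB (h ▸ hp)) hbw
        with rfl | rfl | rfl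
      · exact absurd hw hcB
      · exact absurd hw hdB
      · rfl
    · push Not at h
      exact ⟨b, fun w hw hbw => absurd hbw (h w hw)⟩
  obtain ⟨p, hp⟩ := this
  exact connOn_branch.diff_leaf hp

/-- If the branch of `b` is nontrivial, no vertex of `J` is adjacent to `b`. -/
lemma IsOptimal.no_nbr_of_stem (hO : IsOptimal G J) (hb : Light G J b)
    (hs : (stem G J b).Nonempty) (hu : u ∈ J) : ¬ G.Adj b u := by
  intro hbu
  obtain ⟨c, d, hcd, hc, hd, -⟩ := hO.two hb.1
  obtain ⟨x, hx⟩ := hs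
  obtain ⟨e, he⟩ := exists_adj_of_reachable_ne hx.1 (Ne.symm hx.2)
  have hec : ∀ z, (cycG G J).Adj b z → e ≠ z := by
    rintro z hz rfl
    exact he.2 hz.2
  rcases hO.fourth hc.1.1 hd.1.1 he.1.1 hcd (hec c hc).symm (hec d hd).symm hbu
    with rfl | rfl | rfl
  · exact hc.1.2.2 hu
  · exact hd.1.2.2 hu
  · exact he.1.2.2 hu

lemma IsOptimal.nbr_of_no_stem (hO : IsOptimal G J) (hb : Light G J b)
    (hs : ¬ (stem G J b).Nonempty) : ∃ u ∈ J, G.Adj b u := by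
  obtain ⟨c, d, hcd, hc, hd, hcd'⟩ := hO.two hb.1
  obtain ⟨u, hu, hcu, hdu⟩ := hO.third hc.1.1 hd.1.1 hcd
  refine ⟨u, ?_, hu⟩
  by_contra huJ
  rcases adj_cases (core_adj.2 ⟨hu, hb.notMem, huJ⟩) with h | h
  · rcases hcd' u h with rfl | rfl
    · exact hcu rfl
    · exact hdu rfl
  · exact hs ⟨u, h.reachable, h.ne.symm⟩

lemma IsOptimal.nbr_unique (hO : IsOptimal G J) (hb : Cyc G J b) (hu : u ∈ J) (hv : v ∈ J)
    (hbu : G.Adj b u) (hbv : G.Adj b v) : v = u := by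
  obtain ⟨c, d, hcd, hc, hd, -⟩ := hO.two hb
  rcases hO.fourth hc.1.1 hd.1.1 hbu hcd (fun h => hc.1.2.2 (h ▸ hu))
    (fun h => hd.1.2.2 (h ▸ hu)) hbv with rfl | rfl | rfl
  · exact absurd hv hc.1.2.2
  · exact absurd hv hd.1.2.2
  · rfl

/-- If `u ∈ J` has a neighbour in the branch of `b`, then no other vertex of `J` is adjacent
to `b`. -/
lemma IsOptimal.nbr_eq (hO : IsOptimal G J) (hb : Light G J b) (hu : u ∈ J)
    (hx : x ∈ branch G J b) (hux : G.Adj u x) (hv : v ∈ J) (hbv : G.Adj b v) : v = u := by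
  rcases mem_branch_cases hx with rfl | hx
  · exact hO.nbr_unique hb.1 hu hv hux.symm hbv
  · exact absurd hbv (hO.no_nbr_of_stem hb ⟨x, hx⟩ hv)

lemma IsOptimal.connOn_union_stem (hO : IsOptimal G J) {X : Set V} (hX : ConnOn G X)
    (huX : u ∈ X) (huJ : u ∈ J) (hb : Light G J b) (hx : x ∈ branch G J b) (hux : G.Adj u x) :
    ConnOn G (X ∪ stem G J b) := by
  by_cases hs : (stem G J b).Nonempty
  · rcases mem_branch_cases hx with rfl | hx
    · exact absurd hux.symm (hO.no_nbr_of_stem hb hs huJ)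
    · exact hX.union (hO.connOn_stem hb) huX hx hux
  · rw [Set.not_nonempty_iff_eq_empty.1 hs, Set.union_empty]
    exact hX

/-- A nontrivial branch at `b` contains a leaf of `G - J` other than `b`. -/
lemma IsOptimal.exists_leaf [Finite V] (hO : IsOptimal G J) (hb : Light G J b)
    (hs : (stem G J b).Nonempty) : ∃ y ∈ stem G J b, ∃ p ∈ branch G J b, ∃ u ∈ J, ∃ v ∈ J,
      u ≠ v ∧ G.Adj y p ∧ G.Adj y u ∧ G.Adj y v ∧ ∀ w, G.Adj y w → w = p ∨ w = u ∨ w = v := by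
  obtain ⟨y, hy, hmax⟩ := (Set.toFinite (stem G J b)).exists_maximalFor
    (fun x => (brG G J).dist b x) _ hs
  have hmax' : ∀ x ∈ branch G J b, (brG G J).dist b x ≤ (brG G J).dist b y := by
    intro x hx
    rcases mem_branch_cases hx with rfl | hx
    · simp
    · rcases le_total ((brG G J).dist b x) ((brG G J).dist b y) with h | h
      · exact h
      · exact hmax hx h
  obtain ⟨p, hp⟩ := exists_adj_of_reachable_ne hy.1.symm hy.2
  have hyc : ¬ Cyc G J y := fun h => hy.2 (hb.eq_of_cyc hy.1 h)
  have hleaf : ∀ w, w ∉ J → G.Adj y w → w = p := by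
    intro w hwJ hyw
    by_contra hwp
    rcases adj_cases (core_adj.2 ⟨hyw, hb.stem_notMem hy, hwJ⟩) with h | h
    · exact hyc (cyc_left h)
    · have hpB : p ∈ branch G J b := SimpleGraph.Reachable.trans hy.1 hp.reachable
      have hwB : w ∈ branch G J b := SimpleGraph.Reachable.trans hy.1 h.reachable
      have h1 := avoid_of_dist_le hpB (hmax' p hpB) hp.ne.symm
      have h2 := avoid_of_dist_le hwB (hmax' w hwB) h.ne.symm
      apply h.2
      have h3 : ((core G J).deleteEdges {s(y, w)}).Adj y p := by
        rw [delete_adj]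
        refine ⟨hp.1, ?_⟩
        intro h'
        rw [Sym2.eq_iff] at h'
        rcases h' with ⟨-, h'⟩ | ⟨-, h'⟩
        · exact hwp h'.symm
        · exact hp.ne h'.symm
      refine h3.reachable.trans ((h1.symm.trans h2).mono ?_)
      intro s t hst
      rw [delete_adj]
      refine ⟨hst.1.1, fun h' => ?_⟩
      rw [Sym2.eq_iff] at h'
      rcases h' with ⟨h', -⟩ | ⟨-, h'⟩
      · exact hst.2.1 h'
      · exact hst.2.2 h'
  obtain ⟨u, v, hu, hv, hpu, hpv, huv⟩ := hO.others hp.1.1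
  refine ⟨y, hy, p, SimpleGraph.Reachable.trans hy.1 hp.reachable, u, ?_, v, ?_, huv, hp.1.1,
    hu, hv, fun w hw => hO.fourth hp.1.1 hu hv hpu hpv huv hw⟩
  · by_contra h
    exact hpu (hleaf u h hu).symm
  · by_contra h
    exact hpv (hleaf v h hv).symm

end Local

section Gains

variable {V : Type*} {G : SimpleGraph V} {J : Finset V}

lemma IsOptimal.no_gain (hO : IsOptimal G J) {J' : Finset V} (h : IsNonseparating G J')
    (hlt : J.card < J'.card) : False :=
  absurd (hO.max J' h) (not_le.2 hlt)

/-- A vertex of `J` cannot have neighbours in two light branches of different cycles and a third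
neighbour outside of them. -/
lemma IsOptimal.not_two_branches (hO : IsOptimal G J) {b c u x y z : V} (hb : Light G J b)
    (hc : Light G J c) (hbc : ¬ (cycG G J).Reachable b c) (hu : u ∈ J)
    (hx : x ∈ branch G J b) (hux : G.Adj u x) (hy : y ∈ branch G J c) (huy : G.Adj u y)
    (hzb : z ∉ branch G J b) (hzc : z ∉ branch G J c) (huz : G.Adj u z) : False := by
  have hne : b ≠ c := ne_of_not_reach hbc
  have hzJ : z ∉ J := fun h => hO.indep u hu z h huz
  have hubJ : u ≠ b := fun h => hb.notMem (h ▸ hu)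
  have hucJ : u ≠ c := fun h => hc.notMem (h ▸ hu)
  refine hO.no_gain (J' := insert b (insert c (J.erase u))) ⟨?_, ?_⟩ ?_
  · refine indep_insert (indep_insert ?_ ?_) ?_
    · exact fun a ha b hb => hO.indep a (Finset.mem_of_mem_erase ha) b (Finset.mem_of_mem_erase hb)
    · intro a ha hca
      exact (Finset.ne_of_mem_erase ha) (hO.nbr_eq hc hu hy huy (Finset.mem_of_mem_erase ha) hca)
    · intro a ha hba
      rcases Finset.mem_insert.1 ha with rfl | ha
      · exact hb.not_adj hc hbc mem_branch_self mem_branch_self hba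
      · exact (Finset.ne_of_mem_erase ha) (hO.nbr_eq hb hu hx hux (Finset.mem_of_mem_erase ha) hba)
  · have h0 := hO.connOn_diff_two hb hc hbc
    have h1 := h0.insert (u := u) ⟨⟨hzJ, hzb⟩, hzc⟩ huz
    have h2 := hO.connOn_union_stem h1 (Set.mem_insert _ _) hu hb hx hux
    have h3 := hO.connOn_union_stem h2 (.inl (Set.mem_insert _ _)) hu hc hy huy
    convert h3 using 1
    ext v
    have e1 : v ∈ branch G J b → v ∉ J := hb.branch_notMem
    have e2 : v ∈ branch G J c → v ∉ J := hc.branch_notMem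
    have e3 : v ∈ branch G J b → v ∉ branch G J c := hb.disjoint hc hne
    have e4 : v = b → v ∈ branch G J b := fun h => h ▸ mem_branch_self
    have e5 : v = c → v ∈ branch G J c := fun h => h ▸ mem_branch_self
    simp only [stem, Set.mem_ofPred_eq, Finset.mem_insert, Finset.mem_erase, Set.mem_union,
      Set.mem_insert_iff, Set.mem_sdiff, Set.mem_singleton_iff]
    grind
  · rw [Finset.card_insert_of_notMem, Finset.card_insert_of_notMem, Finset.card_erase_of_mem hu]
    · have := Finset.card_pos.2 ⟨u, hu⟩
      omega
    · simp [hc.notMem]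
    · simp [hb.notMem, hne]

/-- The two neighbours in `J` of a leaf of the branch at `b` cannot both have a second neighbour
in this branch and their third neighbours in light branches of different vertices of other
cycles. -/
lemma IsOptimal.not_pod (hO : IsOptimal G J) {b c d u v p q r s t y : V} (hb : Light G J b)
    (hc : Light G J c) (hd : Light G J d) (hbc : ¬ (cycG G J).Reachable b c)
    (hbd : ¬ (cycG G J).Reachable b d) (hcd : c ≠ d) (hy : y ∈ stem G J b)
    (hu : u ∈ J) (hv : v ∈ J) (huv : u ≠ v) (hyp : p ∈ branch G J b)
    (hyn : ∀ w, G.Adj y w → w = p ∨ w = u ∨ w = v)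
    (hq : q ∈ stem G J b) (hqy : q ≠ y) (huq : G.Adj u q)
    (hr : r ∈ stem G J b) (hry : r ≠ y) (hvr : G.Adj v r)
    (hs : s ∈ branch G J c) (hus : G.Adj u s) (ht : t ∈ branch G J d) (hvt : G.Adj v t) :
    False := by
  have hnbc : b ≠ c := ne_of_not_reach hbc
  have hnbd : b ≠ d := ne_of_not_reach hbd
  have hyJ : y ∉ J := hb.stem_notMem hy
  have hyb : y ≠ b := hy.2
  have hyc : y ≠ c := fun h => hb.disjoint hc hnbc hy.1 (h ▸ mem_branch_self)
  have hyw : ∀ w ∉ J, G.Adj y w → w = p := by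
    intro w hw hyw
    rcases hyn w hyw with h | rfl | rfl
    · exact h
    · exact absurd hu hw
    · exact absurd hv hw
  have hpb : p ≠ b := by
    obtain ⟨w, hw⟩ := exists_adj_of_reachable_ne (hO.connOn_stem hb y hy q hq) hqy.symm
    exact hyw w (hb.stem_notMem hw.2.2) hw.1 ▸ hw.2.2.2
  refine hO.no_gain (J' := insert y (insert b (insert c ((J.erase u).erase v)))) ⟨?_, ?_⟩ ?_
  · refine indep_insert (indep_insert (indep_insert ?_ ?_) ?_) ?_
    · intro a ha b hb
      simp only [Finset.mem_erase] at ha hb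
      exact hO.indep a ha.2.2 b hb.2.2
    · intro a ha hca
      simp only [Finset.mem_erase] at ha
      exact ha.2.1 (hO.nbr_eq hc hu hs hus ha.2.2 hca)
    · intro a ha hba
      simp only [Finset.mem_erase, Finset.mem_insert] at ha
      rcases ha with rfl | ha
      · exact hb.not_adj hc hbc mem_branch_self mem_branch_self hba
      · exact hO.no_nbr_of_stem hb ⟨y, hy⟩ ha.2.2 hba
    · intro a ha hya
      simp only [Finset.mem_erase, Finset.mem_insert] at ha
      rcases ha with rfl | rfl | ha
      · exact hpb (hyw _ hb.notMem hya).symm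
      · exact hb.not_adj hc hbc hy.1 mem_branch_self hya
      · rcases hyn a hya with rfl | rfl | rfl
        · exact hb.branch_notMem hyp ha.2.2
        · exact ha.2.1 rfl
        · exact ha.1 rfl
  · have hD : ConnOn G (stem G J b \ {y}) :=
      (hO.connOn_stem hb).diff_leaf fun w hw h => hyw w (hb.stem_notMem hw) h
    have h0 := hO.connOn_diff_two hb hc hbc
    have h1 := h0.insert (u := v)
      ⟨⟨hd.branch_notMem ht, hd.disjoint hb hnbd.symm ht⟩, hd.disjoint hc hcd.symm ht⟩ hvt
    have h2 := h1.union hD (Set.mem_insert _ _) ⟨hr, hry⟩ hvr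
    have h3 := h2.insert (u := u) (.inr ⟨hq, hqy⟩) huq
    have h4 := hO.connOn_union_stem h3 (Set.mem_insert _ _) hu hc hs hus
    convert h4 using 1
    ext w
    have e1 : w ∈ branch G J b → w ∉ J := hb.branch_notMem
    have e2 : w ∈ branch G J c → w ∉ J := hc.branch_notMem
    have e3 : w ∈ branch G J b → w ∉ branch G J c := hb.disjoint hc hnbc
    have e4 : w = b → w ∈ branch G J b := fun h => h ▸ mem_branch_self
    have e5 : w = c → w ∈ branch G J c := fun h => h ▸ mem_branch_self
    have e6 : w = y → w ∈ branch G J b := fun h => h ▸ hy.1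
    simp only [stem, Set.mem_ofPred_eq, Finset.mem_insert, Finset.mem_erase, Set.mem_union,
      Set.mem_insert_iff, Set.mem_sdiff, Set.mem_singleton_iff]
    grind
  · have hv' : v ∈ J.erase u := by simp [hv, huv.symm]
    rw [Finset.card_insert_of_notMem, Finset.card_insert_of_notMem,
      Finset.card_insert_of_notMem, Finset.card_erase_of_mem hv', Finset.card_erase_of_mem hu]
    · have := Finset.one_lt_card.2 ⟨u, hu, v, hv, huv⟩
      omega
    · simp [hc.notMem]
    · simp [hb.notMem, hnbc]
    · simp [hyJ, hyb, hyc]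

/-- If a leaf of the branch at `b` has neighbours `u` and `v` in `J` such that `v` has another
neighbour in this branch and one in a light branch of another cycle, then `u` cannot have a
neighbour in the light branch at another vertex `c` of the same cycle and a third neighbour
outside it. -/
lemma IsOptimal.not_shift (hO : IsOptimal G J) {b c d u v p q r s t y : V} (hb : Light G J b)
    (hc : Light G J c) (hd : Light G J d) (hbc : (cycG G J).Reachable b c) (hnbc : b ≠ c)
    (hbd : ¬ (cycG G J).Reachable b d) (hy : y ∈ stem G J b)
    (hu : u ∈ J) (hv : v ∈ J) (huv : u ≠ v) (hyu : G.Adj y u)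
    (hyp : p ∈ branch G J b) (hyn : ∀ w, G.Adj y w → w = p ∨ w = u ∨ w = v)
    (hq : q ∈ branch G J b) (hqy : q ≠ y) (hvq : G.Adj v q)
    (hr : r ∈ branch G J d) (hvr : G.Adj v r)
    (hs : s ∈ branch G J c) (hus : G.Adj u s) (ht : t ∉ branch G J c) (hty : t ≠ y)
    (hut : G.Adj u t) : False := by
  have hcd : ¬ (cycG G J).Reachable c d := fun h => hbd (hbc.trans h)
  have hnbd : b ≠ d := ne_of_not_reach hbd
  have hncd : c ≠ d := ne_of_not_reach hcd
  have hyJ : y ∉ J := hb.stem_notMem hy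
  have hyc : y ≠ c := fun h => hb.disjoint hc hnbc hy.1 (h ▸ mem_branch_self)
  have hyd : y ≠ d := fun h => hb.disjoint hd hnbd hy.1 (h ▸ mem_branch_self)
  have htJ : t ∉ J := fun h => hO.indep u hu t h hut
  have htd : t ∉ branch G J d := fun h =>
    hO.not_two_branches hb hd hbd hu hy.1 hyu.symm h hut (hc.disjoint hb hnbc.symm hs)
      (hc.disjoint hd hncd hs) hus
  have hyw : ∀ w ∉ J, G.Adj y w → w = p := by
    intro w hw hyw
    rcases hyn w hyw with h | rfl | rfl
    · exact h
    · exact absurd hu hw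
    · exact absurd hv hw
  refine hO.no_gain (J' := insert y (insert c (insert d ((J.erase u).erase v)))) ⟨?_, ?_⟩ ?_
  · refine indep_insert (indep_insert (indep_insert ?_ ?_) ?_) ?_
    · intro a ha b hb
      simp only [Finset.mem_erase] at ha hb
      exact hO.indep a ha.2.2 b hb.2.2
    · intro a ha hda
      simp only [Finset.mem_erase] at ha
      exact ha.1 (hO.nbr_eq hd hv hr hvr ha.2.2 hda)
    · intro a ha hca
      simp only [Finset.mem_erase, Finset.mem_insert] at ha
      rcases ha with rfl | ha
      · exact hc.not_adj hd hcd mem_branch_self mem_branch_self hca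
      · exact ha.2.1 (hO.nbr_eq hc hu hs hus ha.2.2 hca)
    · intro a ha hya
      simp only [Finset.mem_erase, Finset.mem_insert] at ha
      rcases ha with rfl | rfl | ha
      · exact hc.disjoint hb hnbc.symm mem_branch_self (hb.stem_closed hy hc.notMem hya)
      · exact hb.not_adj hd hbd hy.1 mem_branch_self hya
      · rcases hyn a hya with rfl | rfl | rfl
        · exact hb.branch_notMem hyp ha.2.2
        · exact ha.2.1 rfl
        · exact ha.1 rfl
  · have h0 := (hO.connOn_diff_two hc hd hcd).diff_leaf (y := y) (p := p)
      fun w hw h => hyw w hw.1.1 h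
    have h1 := h0.insert (u := v)
      ⟨⟨⟨hb.branch_notMem hq, hb.disjoint hc hnbc hq⟩, hb.disjoint hd hnbd hq⟩, hqy⟩ hvq
    have h2 := hO.connOn_union_stem h1 (Set.mem_insert _ _) hv hd hr hvr
    have h3 := h2.insert (u := u) (.inl (.inr ⟨⟨⟨htJ, ht⟩, htd⟩, hty⟩)) hut
    have h4 := hO.connOn_union_stem h3 (Set.mem_insert _ _) hu hc hs hus
    convert h4 using 1
    ext w
    have e1 : w ∈ branch G J d → w ∉ J := hd.branch_notMem
    have e2 : w ∈ branch G J c → w ∉ J := hc.branch_notMem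
    have e3 : w ∈ branch G J c → w ∉ branch G J d := hc.disjoint hd hncd
    have e4 : w = d → w ∈ branch G J d := fun h => h ▸ mem_branch_self
    have e5 : w = c → w ∈ branch G J c := fun h => h ▸ mem_branch_self
    have e6 : w = y → w ∉ branch G J c := fun h => h ▸ hb.disjoint hc hnbc hy.1
    have e7 : w = y → w ∉ branch G J d := fun h => h ▸ hb.disjoint hd hnbd hy.1
    simp only [stem, Set.mem_ofPred_eq, Finset.mem_insert, Finset.mem_erase, Set.mem_union,
      Set.mem_insert_iff, Set.mem_sdiff, Set.mem_singleton_iff]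
    grind
  · have hv' : v ∈ J.erase u := by simp [hv, huv.symm]
    rw [Finset.card_insert_of_notMem, Finset.card_insert_of_notMem,
      Finset.card_insert_of_notMem, Finset.card_erase_of_mem hv', Finset.card_erase_of_mem hu]
    · have := Finset.one_lt_card.2 ⟨u, hu, v, hv, huv⟩
      omega
    · simp [hd.notMem]
    · simp [hc.notMem, hncd]
    · simp [hyJ, hyc, hyd]

end Gains

section Ownership

variable {V : Type*} {G : SimpleGraph V} {J : Finset V} {b c d e u v w x y z : V}

/-- `u` has a neighbour in the branch at `b`. -/
def Touches (G : SimpleGraph V) (J : Finset V) (u b : V) : Prop := ∃ x ∈ branch G J b, G.Adj u x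

/-- `u ∈ J` has two neighbours in the light branch at `b` and one in the light branch at `c`,
where `b` and `c` lie on different cycles. -/
structure Foreign (G : SimpleGraph V) (J : Finset V) (b c u : V) : Prop where
  mem : u ∈ J
  left : Light G J b
  right : Light G J c
  ne : ¬ (cycG G J).Reachable b c
  nbrs : ∃ x y z, x ≠ y ∧ x ∈ branch G J b ∧ y ∈ branch G J b ∧ z ∈ branch G J c ∧
    G.Adj u x ∧ G.Adj u y ∧ G.Adj u z

/-- `u` is the chosen one of at least two vertices that are foreign at `b`, `c`. -/
def Picked (G : SimpleGraph V) (J : Finset V) (b c u : V) : Prop :=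
  ∃ h : ∃ p : V × V, p.1 ≠ p.2 ∧ Foreign G J b c p.1 ∧ Foreign G J b c p.2, h.choose.1 = u

/-- The vertex `u ∈ J` is assigned to the cycle `C` of `G - J`. -/
def Owns (G : SimpleGraph V) (J : Finset V) (u : V) (C : (cycG G J).ConnectedComponent) : Prop :=
  (∃ b c, Foreign G J b c u ∧ ((Picked G J b c u ∧ (cycG G J).connectedComponentMk b = C) ∨
    (¬ Picked G J b c u ∧ (cycG G J).connectedComponentMk c = C))) ∨
  (u ∈ J ∧ (∀ b c, ¬ Foreign G J b c u) ∧
    ∃ b, Light G J b ∧ Touches G J u b ∧ (cycG G J).connectedComponentMk b = C)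

lemma Picked.foreign (h : Picked G J b c u) : Foreign G J b c u := by
  obtain ⟨h, rfl⟩ := h
  exact h.choose_spec.2.1

lemma Picked.eq (hu : Picked G J b c u) (hv : Picked G J b c v) : u = v := by
  obtain ⟨h, rfl⟩ := hu
  obtain ⟨h, rfl⟩ := hv
  rfl

lemma exists_picked (hu : Foreign G J b c u) (hv : Foreign G J b c v) (huv : u ≠ v) :
    ∃ w, Picked G J b c w := ⟨_, ⟨(u, v), huv, hu, hv⟩, rfl⟩

lemma Foreign.exists_not_picked (hu : Foreign G J b c u) :
    ∃ v, Foreign G J b c v ∧ ¬ Picked G J b c v := by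
  by_cases h : Picked G J b c u
  · obtain ⟨h', rfl⟩ := id h
    refine ⟨h'.choose.2, h'.choose_spec.2.2, fun h2 => h'.choose_spec.1 (h.eq h2)⟩
  · exact ⟨u, hu, h⟩

lemma Foreign.mem_of_adj (hG : IsCubicTwoEdgeConn G) (h : Foreign G J b c u) (hw : G.Adj u w) :
    w ∈ branch G J b ∨ w ∈ branch G J c := by
  obtain ⟨x, y, z, hxy, hx, hy, hz, hux, huy, huz⟩ := h.nbrs
  have hd := fun w => h.left.disjoint (x := w) h.right (ne_of_not_reach h.ne)
  rcases hG.fourth hux huy huz hxy (fun h => hd _ hx (h ▸ hz)) (fun h => hd _ hy (h ▸ hz)) hw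
    with rfl | rfl | rfl
  · exact .inl hx
  · exact .inl hy
  · exact .inr hz

lemma Foreign.eq_of_touches (hG : IsCubicTwoEdgeConn G) (h : Foreign G J b c u)
    (hd : Light G J d) (hud : Touches G J u d) : d = b ∨ d = c := by
  obtain ⟨w, hw, huw⟩ := hud
  by_contra! hne
  rcases h.mem_of_adj hG huw with h' | h'
  · exact hd.disjoint h.left hne.1 hw h'
  · exact hd.disjoint h.right hne.2 hw h'

lemma Foreign.touches_left (h : Foreign G J b c u) : Touches G J u b := by
  obtain ⟨x, y, z, hxy, hx, hy, hz, hux, huy, huz⟩ := h.nbrs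
  exact ⟨x, hx, hux⟩

lemma Foreign.touches_right (h : Foreign G J b c u) : Touches G J u c := by
  obtain ⟨x, y, z, hxy, hx, hy, hz, hux, huy, huz⟩ := h.nbrs
  exact ⟨z, hz, huz⟩

lemma Foreign.second (h : Foreign G J b c u) (y : V) :
    ∃ q ∈ branch G J b, q ≠ y ∧ G.Adj u q := by
  obtain ⟨x, y', z, hxy, hx, hy, hz, hux, huy, huz⟩ := h.nbrs
  by_cases hxy' : x = y
  · exact ⟨y', hy, fun h => hxy (hxy'.trans h.symm), huy⟩
  · exact ⟨x, hx, hxy', hux⟩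

lemma Foreign.not_swap (hG : IsCubicTwoEdgeConn G) (h : Foreign G J b c u) :
    ¬ Foreign G J c b u := by
  intro h'
  obtain ⟨x, y, z, hxy, hx, hy, hz, hux, huy, huz⟩ := h.nbrs
  obtain ⟨x', y', z', hxy', hx', hy', hz', hux', huy', huz'⟩ := h'.nbrs
  have hd := fun w => h.left.disjoint (x := w) h.right (ne_of_not_reach h.ne)
  have hf := fun w => hG.fourth (d := w) hux huy huz hxy (fun h => hd _ hx (h ▸ hz))
    (fun h => hd _ hy (h ▸ hz))
  have key : ∀ w, G.Adj u w → w ∈ branch G J c → w = z := by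
    intro w huw hw
    rcases hf w huw with rfl | rfl | rfl
    · exact absurd hw (hd _ hx)
    · exact absurd hw (hd _ hy)
    · rfl
  exact hxy' ((key _ hux' hx').trans (key _ huy' hy').symm)

lemma Foreign.unique (hG : IsCubicTwoEdgeConn G) (h : Foreign G J b c u)
    (h' : Foreign G J d e u) : d = b ∧ e = c := by
  rcases h.eq_of_touches hG h'.left h'.touches_left with rfl | rfl <;>
    rcases h.eq_of_touches hG h'.right h'.touches_right with rfl | rfl
  · exact absurd .rfl h'.ne
  · exact ⟨rfl, rfl⟩
  · exact absurd h' (h.not_swap hG)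
  · exact absurd .rfl h'.ne

lemma IsOptimal.reach_of_not_foreign (hO : IsOptimal G J) (hu : u ∈ J)
    (hf : ∀ b c, ¬ Foreign G J b c u) (hb : Light G J b) (hc : Light G J c)
    (hub : Touches G J u b) (huc : Touches G J u c) : (cycG G J).Reachable b c := by
  by_contra hbc
  obtain ⟨x, hx, hux⟩ := hub
  obtain ⟨y, hy, huy⟩ := huc
  have hbc' := ne_of_not_reach hbc
  have hxy : x ≠ y := fun h => hb.disjoint hc hbc' hx (h ▸ hy)
  obtain ⟨z, huz, hxz, hyz⟩ := hO.third hux huy hxy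
  by_cases hzb : z ∈ branch G J b
  · exact hf b c ⟨hu, hb, hc, hbc, x, z, y, hxz, hx, hzb, hy, hux, huz, huy⟩
  by_cases hzc : z ∈ branch G J c
  · exact hf c b ⟨hu, hc, hb, fun h => hbc h.symm, y, z, x, hyz, hy, hzc, hx, huy, huz, hux⟩
  exact hO.not_two_branches hb hc hbc hu hx hux hy huy hzb hzc huz

lemma Owns.mem {C : (cycG G J).ConnectedComponent} (h : Owns G J u C) : u ∈ J := by
  rcases h with ⟨b, c, h, -⟩ | ⟨h, -⟩
  · exact h.mem
  · exact h

lemma IsOptimal.owns_unique (hO : IsOptimal G J) {C D : (cycG G J).ConnectedComponent}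
    (hC : Owns G J u C) (hD : Owns G J u D) : C = D := by
  rcases hC with ⟨b, c, h, h1⟩ | ⟨hu, h, b, hb, hub, rfl⟩ <;>
    rcases hD with ⟨b', c', h', h1'⟩ | ⟨-, h', b', hb', hub', rfl⟩
  · obtain ⟨rfl, rfl⟩ := h.unique hO.toIsCubicTwoEdgeConn h'
    rcases h1 with ⟨h1, rfl⟩ | ⟨h1, rfl⟩ <;> rcases h1' with ⟨h1', rfl⟩ | ⟨h1', rfl⟩
    · rfl
    · exact absurd h1 h1'
    · exact absurd h1' h1
    · rfl
  · exact absurd h (h' _ _)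
  · exact absurd h' (h _ _)
  · exact SimpleGraph.ConnectedComponent.eq.2 (hO.reach_of_not_foreign hu h hb hb' hub hub')

lemma owns_of_not_foreign (hu : u ∈ J) (h : ∀ b c, ¬ Foreign G J b c u) (hb : Light G J b)
    (hub : Touches G J u b) : Owns G J u ((cycG G J).connectedComponentMk b) :=
  .inr ⟨hu, h, b, hb, hub, rfl⟩

lemma Picked.owns (h : Picked G J b c u) : Owns G J u ((cycG G J).connectedComponentMk b) :=
  .inl ⟨b, c, h.foreign, .inl ⟨h, rfl⟩⟩

lemma Foreign.exists_owns_right (h : Foreign G J b c u) :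
    ∃ v, Foreign G J b c v ∧ Owns G J v ((cycG G J).connectedComponentMk c) := by
  obtain ⟨v, hv, hv'⟩ := h.exists_not_picked
  exact ⟨v, hv, .inl ⟨b, c, hv, .inr ⟨hv', rfl⟩⟩⟩

/-- Two vertices foreign at `b` and adjacent to the same leaf of the branch at `b` have the same
third branch. -/
lemma IsOptimal.foreign_leaf (hO : IsOptimal G J) {p : V} (hy : y ∈ stem G J b)
    (hp : p ∈ branch G J b) (huv : u ≠ v)
    (hyn : ∀ w, G.Adj y w → w = p ∨ w = u ∨ w = v) (hfu : Foreign G J b c u)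
    (hfv : Foreign G J b d v) : c = d := by
  by_contra hcd
  have hs : ∀ w ∈ J, ∀ q ∈ branch G J b, G.Adj w q → q ∈ stem G J b := by
    intro w hw q hq hwq
    rcases mem_branch_cases hq with rfl | h
    · exact absurd hwq.symm (hO.no_nbr_of_stem hfu.left ⟨y, hy⟩ hw)
    · exact h
  obtain ⟨q, hq, hqy, huq⟩ := hfu.second y
  obtain ⟨r, hr, hry, hvr⟩ := hfv.second y
  obtain ⟨s, hs1, hus⟩ := hfu.touches_right
  obtain ⟨t, ht, hvt⟩ := hfv.touches_right
  exact hO.not_pod hfu.left hfu.right hfv.right hfu.ne hfv.ne hcd hy hfu.mem hfv.mem huv hp hyn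
    (hs _ hfu.mem _ hq huq) hqy huq (hs _ hfv.mem _ hr hvr) hry hvr hs1 hus ht hvt

/-- A vertex of `J` touching a light branch is owned by its cycle, or some foreign vertex is, or
it is foreign with two neighbours in this branch. -/
lemma touch_cases (hG : IsCubicTwoEdgeConn G) (hb : Light G J b) (hu : u ∈ J)
    (hub : Touches G J u b) :
    (Owns G J u ((cycG G J).connectedComponentMk b) ∧ ∀ c d, ¬ Foreign G J c d u) ∨
    (∃ c v, Foreign G J c b v ∧ Owns G J v ((cycG G J).connectedComponentMk b)) ∨
    ∃ c, Foreign G J b c u := by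
  by_cases h : ∀ c d, ¬ Foreign G J c d u
  · exact .inl ⟨owns_of_not_foreign hu h hb hub, h⟩
  · push Not at h
    obtain ⟨c, d, h⟩ := h
    rcases h.eq_of_touches hG hb hub with rfl | rfl
    · exact .inr (.inr ⟨d, h⟩)
    · obtain ⟨v, hv, hv'⟩ := h.exists_owns_right
      exact .inr (.inl ⟨c, v, hv, hv'⟩)

lemma IsOptimal.served [Finite V] (hO : IsOptimal G J) (hb : Light G J b) :
    ∃ u, Owns G J u ((cycG G J).connectedComponentMk b) ∧ Touches G J u b := by
  have hG := hO.toIsCubicTwoEdgeConn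
  by_cases hs : (stem G J b).Nonempty
  · obtain ⟨y, hy, p, hp, u, hu, v, hv, huv, hyp, hyu, hyv, hyn⟩ := hO.exists_leaf hb hs
    have hub : Touches G J u b := ⟨y, hy.1, hyu.symm⟩
    have hvb : Touches G J v b := ⟨y, hy.1, hyv.symm⟩
    rcases touch_cases hG hb hu hub with ⟨h, -⟩ | ⟨c, w, h, h'⟩ | ⟨c, hc⟩
    · exact ⟨u, h, hub⟩
    · exact ⟨w, h', h.touches_right⟩
    rcases touch_cases hG hb hv hvb with ⟨h, -⟩ | ⟨d, w, h, h'⟩ | ⟨d, hd⟩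
    · exact ⟨v, h, hvb⟩
    · exact ⟨w, h', h.touches_right⟩
    obtain rfl := hO.foreign_leaf hy hp huv hyn hc hd
    obtain ⟨w, hw⟩ := exists_picked hc hd huv
    exact ⟨w, hw.owns, hw.foreign.touches_left⟩
  · obtain ⟨u, hu, hbu⟩ := hO.nbr_of_no_stem hb hs
    have hub : Touches G J u b := ⟨b, mem_branch_self, hbu.symm⟩
    rcases touch_cases hG hb hu hub with ⟨h, -⟩ | ⟨c, w, h, h'⟩ | ⟨c, hc⟩
    · exact ⟨u, h, hub⟩
    · exact ⟨w, h', h.touches_right⟩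
    · obtain ⟨q, hq, hqb, -⟩ := hc.second b
      exact absurd ⟨q, hq, hqb⟩ hs

/-- Every vertex of `G - J` that is joined to a cycle is joined to some cycle by bridges. -/
lemma exists_cyc_bridge {K : SimpleGraph V} (hK : K ≤ core G J) (h : K.Reachable x y)
    (hy : Cyc G J y) : ∃ z, Cyc G J z ∧ (brG G J).Reachable x z ∧ K.Reachable x z := by
  by_cases hx : Cyc G J x
  · exact ⟨x, hx, .rfl, .rfl⟩
  · obtain ⟨p, q, hpq, hp, hq, hxp⟩ := first_entry (S := {v | Cyc G J v}) h hx hy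
    have hbr : ∀ {s t : V}, K.Adj s t → ¬ Cyc G J s → (brG G J).Adj s t := by
      intro s t hst hs
      exact (adj_cases (hK hst)).resolve_left fun h => hs (cyc_left h)
    refine ⟨q, hq, ?_, (hxp.mono (within_le _ _)).trans hpq.reachable⟩
    have h1 : (brG G J).Reachable x p := by
      refine hxp.mono ?_
      intro s t hst
      exact hbr hst.1 hst.2.1
    exact h1.trans (hbr hpq hp).reachable

/-- If `G - J` has another cycle, then not all vertices of a given cycle are light. -/
lemma IsOptimal.exists_not_light (hO : IsOptimal G J) (hv : Cyc G J v) (hw : Cyc G J w)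
    (hvw : ¬ (cycG G J).Reachable v w) : ∃ q, (cycG G J).Reachable v q ∧ ¬ Light G J q := by
  obtain ⟨p, q, hpq, hp, hq, hwp⟩ := first_entry (S := {x | (cycG G J).Reachable v x})
    (hO.conn w hw.notMem v hv.notMem) hvw .rfl
  refine ⟨q, hq, fun hl => ?_⟩
  have hbr : (brG G J).Adj p q :=
    (adj_cases hpq).resolve_left fun h => hp (SimpleGraph.Reachable.trans hq h.symm.reachable)
  obtain ⟨z, hz, hz1, hz2⟩ := exists_cyc_bridge (J := J) (within_le _ _) hwp.symm hw
  obtain rfl := hl.2 z (hbr.symm.reachable.trans hz1) hz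
  refine reach_inv (fun x => ¬ (cycG G J).Reachable v x) ?_ hz2 hp hq
  intro x y h hx
  exact h.2.2

end Ownership

section Claim

variable {V : Type*} {G : SimpleGraph V} {J : Finset V} {b c u v w x y z : V}

lemma IsOptimal.leaf_foreign [Finite V] (hO : IsOptimal G J) (hb : Light G J b)
    (hs : (stem G J b).Nonempty)
    (hall : ∀ v, Owns G J v ((cycG G J).connectedComponentMk b) → v = u)
    (hf : ∀ c d, ¬ Foreign G J c d u) :
    ∃ y ∈ stem G J b, ∃ p ∈ branch G J b, ∃ v d, v ≠ u ∧ Foreign G J b d v ∧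
      G.Adj y u ∧ G.Adj y v ∧ ∀ w, G.Adj y w → w = p ∨ w = u ∨ w = v := by
  obtain ⟨y, hy, p, hp, s, hs, t, ht, hst, hyp, hys, hyt, hyn⟩ := hO.exists_leaf hb hs
  have key : ∀ w ∈ J, G.Adj y w → w = u ∨ ∃ c, Foreign G J b c w := by
    intro w hw hyw
    rcases touch_cases hO.toIsCubicTwoEdgeConn hb hw ⟨y, hy.1, hyw.symm⟩ with
      ⟨h, -⟩ | ⟨c, v, h, h'⟩ | h
    · exact .inl (hall w h)
    · obtain rfl := hall v h'
      exact absurd h (hf _ _)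
    · exact .inr h
  rcases key s hs hys with rfl | ⟨c, hc⟩
  · rcases key t ht hyt with rfl | ⟨d, hd⟩
    · exact absurd rfl hst
    · exact ⟨y, hy, p, hp, t, d, hst.symm, hd, hys, hyt, hyn⟩
  · rcases key t ht hyt with rfl | ⟨d, hd⟩
    · exact ⟨y, hy, p, hp, s, c, hst, hc, hyt, hys, fun w hw => by have := hyn w hw; tauto⟩
    · obtain rfl := hO.foreign_leaf hy hp hst hyn hc hd
      obtain ⟨w, hw⟩ := exists_picked hc hd hst
      obtain rfl := hall w hw.owns
      exact absurd hw.foreign (hf _ _)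

/-- If a cycle with two light vertices `b` and `c` owns only one vertex `u ∈ J`, then the branch
at `b` is trivial. -/
lemma IsOptimal.no_stem [Finite V] (hO : IsOptimal G J) (hb : Light G J b) (hc : Light G J c)
    (hbc : (cycG G J).Reachable b c) (hne : b ≠ c) (hu : u ∈ J)
    (hall : ∀ v, Owns G J v ((cycG G J).connectedComponentMk b) → v = u)
    (hf : ∀ c d, ¬ Foreign G J c d u) (huc : Touches G J u c) : ¬ (stem G J b).Nonempty := by
  intro hs
  obtain ⟨y, hy, p, hp, v, d, hvu, hv, hyu, hyv, hyn⟩ := hO.leaf_foreign hb hs hall hf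
  obtain ⟨x, hx, hux⟩ := huc
  have hyx : y ≠ x := fun h => hb.disjoint hc hne hy.1 (h ▸ hx)
  obtain ⟨z, huz, hyz, hxz⟩ := hO.third hyu.symm hux hyx
  obtain ⟨q, hq, hqy, hvq⟩ := hv.second y
  obtain ⟨r, hr, hvr⟩ := hv.touches_right
  by_cases hz : z ∈ branch G J c
  · have hsc : (stem G J c).Nonempty := by
      rcases mem_branch_cases hz with rfl | h
      · rcases mem_branch_cases hx with rfl | h
        · exact absurd rfl hxz
        · exact ⟨x, h⟩
      · exact ⟨z, h⟩
    rw [SimpleGraph.ConnectedComponent.eq.2 hbc] at hall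
    obtain ⟨y', hy', p', hp', v', d', hvu', hv', hyu', hyv', hyn'⟩ := hO.leaf_foreign hc hsc hall hf
    obtain ⟨q', hq', hqy', hvq'⟩ := hv'.second y'
    obtain ⟨r', hr', hvr'⟩ := hv'.touches_right
    obtain ⟨t, ht, hty, hut⟩ : ∃ t ∈ branch G J c, t ≠ y' ∧ G.Adj u t := by
      by_cases hxy : x = y'
      · exact ⟨z, hz, fun h => hxz (hxy.trans h.symm), huz⟩
      · exact ⟨x, hx, hxy, hux⟩
    exact hO.not_shift hc hb hv'.right hbc.symm hne.symm hv'.ne hy' hu hv'.mem hvu'.symm hyu' hp'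
      hyn' hq' hqy' hvq' hr' hvr' hy.1 hyu.symm (hc.disjoint hb hne.symm ht) hty hut
  · exact hO.not_shift hb hc hv.right hbc hne hv.ne hy hu hv.mem hvu.symm hyu hp
      hyn hq hqy hvq hr hvr hx hux hz hyz.symm huz

/-- Exchanging `u ∈ J` for a vertex of a triangle of `G - J` would create more vertices on
cycles. -/
lemma IsOptimal.not_exchange [Finite V] (hO : IsOptimal G J) {x₀ x₁ x₂ : V}
    (hl : Light G J x₁) (h10 : (cycG G J).Adj x₁ x₀) (h02 : (cycG G J).Adj x₀ x₂)
    (hbr : branch G J x₁ = {x₁}) (h12 : x₁ ≠ x₂)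
    (hu : u ∈ J) (hu2 : G.Adj u x₂) (huz : G.Adj u z) (hz1 : z ≠ x₁) (hz2 : z ≠ x₂)
    (hw : w ∉ J) (hwC : ¬ (cycG G J).Reachable x₁ w)
    (hn0 : ∀ v, G.Adj x₀ v ↔ v = x₁ ∨ v = x₂ ∨ v = w)
    (hn1 : ∀ v, G.Adj x₁ v → v = u ∨ v = x₀ ∨ v = x₂)
    (hn2 : ∀ v, G.Adj x₂ v → v = u ∨ v = x₀ ∨ v = x₁)
    (hC : ∀ v, (cycG G J).Reachable x₁ v → v = x₀ ∨ v = x₁ ∨ v = x₂) : False := by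
  have hx0 : x₀ ∉ J := h10.1.2.2
  have hx1 : x₁ ∉ J := h10.1.2.1
  have hx2 : x₂ ∉ J := h02.1.2.2
  have h01 : x₀ ≠ x₁ := h10.ne.symm
  have h02' : x₀ ≠ x₂ := h02.ne
  have hxw : G.Adj x₀ w := (hn0 w).2 (by simp)
  have hw1 : w ≠ x₁ := fun h => hwC (h ▸ .rfl)
  have hw2 : w ≠ x₂ := fun h => hwC (h ▸ h10.reachable.trans h02.reachable)
  have hzJ : z ∉ J := fun h => hO.indep u hu z h huz
  have hz0 : z ≠ x₀ := by
    rintro rfl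
    rcases (hn0 u).1 huz.symm with rfl | rfl | rfl
    · exact hx1 hu
    · exact hx2 hu
    · exact hw hu
  set S : Set V := {x₀, x₁, x₂} with hS
  have hpath : (within (core G J) Sᶜ).Reachable z w := by
    obtain ⟨p, q, hpq, hp, hq, hzp⟩ := first_entry (S := S) (hO.conn z hzJ x₀ hx0)
      (by simp [hS, hz0, hz1, hz2]) (by simp [hS])
    have hpu : p ≠ u := fun h => hpq.2.1 (h ▸ hu)
    simp only [hS, Set.mem_insert_iff, Set.mem_singleton_iff, not_or] at hp hq
    rcases hq with rfl | rfl | rfl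
    · rcases (hn0 p).1 hpq.1.symm with h | h | rfl
      · exact absurd h hp.2.1
      · exact absurd h hp.2.2
      · exact hzp
    · have := hn1 p hpq.1.symm
      tauto
    · have := hn2 p hpq.1.symm
      tauto
  set J' := insert x₁ (J.erase u) with hJ'
  have hmem : ∀ v, v ∉ J' ↔ v ≠ x₁ ∧ (v = u ∨ v ∉ J) := by
    intro v
    simp only [hJ', Finset.mem_insert, Finset.mem_erase]
    tauto
  have hux1 : u ≠ x₁ := fun h => hx1 (h ▸ hu)
  have hcard : J'.card = J.card := by
    rw [hJ', Finset.card_insert_of_notMem (by simp [hx1]), Finset.card_erase_of_mem hu]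
    have := Finset.card_pos.2 ⟨u, hu⟩
    omega
  have hns : IsNonseparating G J' := by
    refine ⟨indep_insert ?_ ?_, ?_⟩
    · exact fun a ha b hb => hO.indep a (Finset.mem_of_mem_erase ha) b (Finset.mem_of_mem_erase hb)
    · intro a ha h
      rw [Finset.mem_erase] at ha
      rcases hn1 a h with rfl | rfl | rfl
      · exact ha.1 rfl
      · exact hx0 ha.2
      · exact hx2 ha.2
    · have h0 := hO.connOn_diff_one hl
      rw [hbr] at h0
      have h1 := h0.insert (u := u) ⟨hx2, h12.symm⟩ hu2
      convert h1 using 1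
      ext v
      simp only [hmem, Set.mem_ofPred_eq, Set.mem_insert_iff, Set.mem_sdiff,
        Set.mem_singleton_iff]
      by_cases h : v = u
      · simp [h, hux1]
      · simp [h, and_comm]
  have hM : IsMaximum G J' :=
    { toIsCubicTwoEdgeConn := hO.toIsCubicTwoEdgeConn
      toIsNonseparating := hns
      max := fun A hA => hcard ▸ hO.max A hA }
  have hle : within (core G J) Sᶜ ≤ core G J' := by
    intro s t hst
    refine ⟨hst.1.1, (hmem s).2 ⟨?_, .inr hst.1.2.1⟩, (hmem t).2 ⟨?_, .inr hst.1.2.2⟩⟩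
    · rintro rfl
      exact hst.2.1 (by simp [hS])
    · rintro rfl
      exact hst.2.2 (by simp [hS])
  have hdel : ∀ e f, e ∈ S → (within (core G J) Sᶜ).Reachable z w →
      ((core G J').deleteEdges {s(e, f)}).Reachable z w := by
    intro e f he h
    refine h.mono ?_
    intro s t hst
    rw [delete_adj]
    refine ⟨hle hst, fun h => ?_⟩
    rw [Sym2.eq_iff] at h
    rcases h with ⟨h, -⟩ | ⟨-, h⟩
    · exact hst.2.1 (h ▸ he)
    · exact hst.2.2 (h ▸ he)
  have k02 : (core G J').Adj x₀ x₂ :=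
    ⟨h02.1.1, (hmem _).2 ⟨h01, .inr hx0⟩, (hmem _).2 ⟨h12.symm, .inr hx2⟩⟩
  have k0w : (core G J').Adj x₀ w :=
    ⟨hxw, (hmem _).2 ⟨h01, .inr hx0⟩, (hmem _).2 ⟨hw1, .inr hw⟩⟩
  have ku2 : (core G J').Adj u x₂ :=
    ⟨hu2, (hmem _).2 ⟨hux1, .inl rfl⟩, (hmem _).2 ⟨h12.symm, .inr hx2⟩⟩
  have kuz : (core G J').Adj u z :=
    ⟨huz, (hmem _).2 ⟨hux1, .inl rfl⟩, (hmem _).2 ⟨hz1, .inr hzJ⟩⟩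
  have hu0 : u ≠ x₀ := fun h => hx0 (h ▸ hu)
  have hu2' : u ≠ x₂ := fun h => hx2 (h ▸ hu)
  have huw : u ≠ w := fun h => hw (h ▸ hu)
  have n0w : (cycG G J').Adj x₀ w := by
    refine ⟨k0w, ?_⟩
    have e1 : ((core G J').deleteEdges {s(x₀, w)}).Adj x₀ x₂ := by
      rw [delete_adj]
      exact ⟨k02, by simp [hw2.symm, h02'.symm]⟩
    have e2 : ((core G J').deleteEdges {s(x₀, w)}).Adj x₂ u := by
      rw [delete_adj]
      exact ⟨ku2.symm, by simp [h02'.symm, hu0]⟩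
    have e3 : ((core G J').deleteEdges {s(x₀, w)}).Adj u z := by
      rw [delete_adj]
      exact ⟨kuz, by simp [hu0, huw]⟩
    exact e1.reachable.trans (e2.reachable.trans (e3.reachable.trans
      (hdel _ _ (by simp [hS]) hpath)))
  have nu2 : (cycG G J').Adj u x₂ := by
    refine ⟨ku2, ?_⟩
    have e1 : ((core G J').deleteEdges {s(u, x₂)}).Adj u z := by
      rw [delete_adj]
      exact ⟨kuz, by simp [hz2, hu2']⟩
    have e2 : ((core G J').deleteEdges {s(u, x₂)}).Adj w x₀ := by
      rw [delete_adj]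
      exact ⟨k0w.symm, by simp [huw.symm, hw2]⟩
    have e3 : ((core G J').deleteEdges {s(u, x₂)}).Adj x₀ x₂ := by
      rw [delete_adj]
      exact ⟨k02, by simp [hu0.symm, h02']⟩
    have e4 := hdel x₂ u (by simp [hS]) hpath
    rw [Sym2.eq_swap] at e4
    exact e1.reachable.trans (e4.trans (e2.reachable.trans e3.reachable))
  have keep : ∀ s t, ¬ (cycG G J).Reachable x₁ s → (cycG G J).Adj s t → (cycG G J').Adj s t := by
    have hadj : ∀ s t, ¬ (cycG G J).Reachable x₁ s → (cycG G J).Adj s t →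
        (core G J').Adj s t := by
      intro s t hs hst
      refine ⟨hst.1.1, (hmem _).2 ⟨?_, .inr hst.1.2.1⟩, (hmem _).2 ⟨?_, .inr hst.1.2.2⟩⟩
      · rintro rfl
        exact hs .rfl
      · rintro rfl
        exact hs hst.symm.reachable
    intro s t hs hst
    refine ⟨hadj s t hs hst, ?_⟩
    refine reach_sub (fun v => ¬ (cycG G J).Reachable x₁ v) ?_ ?_ (cyclicPart_reachable hst) hs
    · intro a b h ha hb
      rw [delete_adj] at h
      exact ha (hb.trans h.1.symm.reachable)
    · intro a b h ha _
      rw [delete_adj] at h ⊢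
      exact ⟨hadj a b ha h.1, h.2⟩
  have hwc : ¬ Cyc G J w := by
    intro h
    obtain ⟨c, d, hcd, hc, hd, -⟩ := hO.two h
    have h0 : ∀ c, (cycG G J).Adj w c → x₀ ≠ c := by
      rintro c hc rfl
      exact hwC (h10.reachable.trans hc.symm.reachable)
    exact hM.not_three n0w.symm (keep w c hwC hc) (keep w d hwC hd) (h0 c hc) (h0 d hd) hcd
  have hsub : insert u (insert w ({v | Cyc G J v} \ {x₁})) ⊆ {v | Cyc G J' v} := by
    rintro v (rfl | rfl | ⟨hv, hv1⟩)
    · exact cyc_left nu2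
    · exact cyc_right n0w
    · by_cases h : (cycG G J).Reachable x₁ v
      · rcases hC v h with rfl | rfl | rfl
        · exact cyc_left n0w
        · exact absurd rfl hv1
        · exact cyc_right nu2
      · obtain ⟨t, ht⟩ := hv
        exact cyc_left (keep v t h ht)
  have h1 := Set.ncard_le_ncard hsub
  have hfin : ({v | Cyc G J v} \ {x₁} : Set V).Finite := Set.toFinite _
  rw [Set.ncard_insert_of_notMem _ (hfin.insert w), Set.ncard_insert_of_notMem _ hfin] at h1
  · have h2 := Set.ncard_sdiff_singleton_add_one (s := {v | Cyc G J v}) (a := x₁) (cyc_left h10)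
    have h3 := hO.max_cyc J' hns hcard
    change {v | Cyc G J' v}.ncard ≤ {v | Cyc G J v}.ncard at h3
    omega
  · exact fun h => hwc h.1
  · rintro (h | h)
    · exact huw h
    · exact Cyc.notMem h.1 hu

/-- A cycle all of whose vertices but one are light owns at least two vertices of `J`. -/
lemma IsOptimal.not_owns_one [Finite V] (hO : IsOptimal G J) {x₀ : V} (hx0 : Cyc G J x₀)
    (hv : Cyc G J v) (hvx : ¬ (cycG G J).Reachable x₀ v) (hnl : ¬ Light G J x₀)
    (hl : ∀ x, (cycG G J).Reachable x₀ x → x ≠ x₀ → Light G J x)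
    (hall : ∀ u w, Owns G J u ((cycG G J).connectedComponentMk x₀) →
      Owns G J w ((cycG G J).connectedComponentMk x₀) → u = w) : False := by
  obtain ⟨x₁, x₂, h12, h01, h02, hx0n⟩ := hO.two hx0
  have hl1 := hl x₁ h01.reachable h01.ne.symm
  have hl2 := hl x₂ h02.reachable h02.ne.symm
  have hmk : ∀ x, (cycG G J).Reachable x₀ x →
      (cycG G J).connectedComponentMk x = (cycG G J).connectedComponentMk x₀ := fun x hx =>
    SimpleGraph.ConnectedComponent.eq.2 hx.symm
  obtain ⟨u, hu, hu1⟩ := hO.served hl1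
  rw [hmk _ h01.reachable] at hu
  have huJ := hu.mem
  have htouch : ∀ x, (cycG G J).Reachable x₀ x → x ≠ x₀ → Touches G J u x := by
    intro x hx hne
    obtain ⟨w, hw, hwx⟩ := hO.served (hl x hx hne)
    rw [hmk _ hx] at hw
    rwa [hall u w hu hw]
  have hu2 := htouch x₂ h02.reachable h02.ne.symm
  have hf : ∀ c d, ¬ Foreign G J c d u := by
    intro c d h
    rcases h.eq_of_touches hO.toIsCubicTwoEdgeConn hl1 hu1 with rfl | rfl <;>
      rcases h.eq_of_touches hO.toIsCubicTwoEdgeConn hl2 hu2 with h' | h'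
    · exact h12 h'.symm
    · exact h.ne (h' ▸ (h01.reachable.symm.trans h02.reachable))
    · exact h.ne (h' ▸ (h02.reachable.symm.trans h01.reachable))
    · exact h12 h'.symm
  have hbranch : ∀ x, (cycG G J).Reachable x₀ x → x ≠ x₀ → branch G J x = {x} := by
    intro x hx hne
    obtain ⟨c, hc, hc0, hxc⟩ : ∃ c, (cycG G J).Reachable x₀ c ∧ c ≠ x₀ ∧ x ≠ c := by
      by_cases h : x = x₁
      · exact ⟨x₂, h02.reachable, h02.ne.symm, h ▸ h12⟩
      · exact ⟨x₁, h01.reachable, h01.ne.symm, h⟩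
    have := hO.no_stem (hl x hx hne) (hl c hc hc0) (hx.symm.trans hc) hxc huJ
      (fun v hv => hall v u (hmk x hx ▸ hv) hu) hf (htouch c hc hc0)
    refine Set.Subset.antisymm ?_ (Set.singleton_subset_iff.2 mem_branch_self)
    intro y hy
    by_contra hyx
    exact this ⟨y, hy, hyx⟩
  have hadj : ∀ x, (cycG G J).Reachable x₀ x → x ≠ x₀ → G.Adj u x := by
    intro x hx hne
    obtain ⟨y, hy, huy⟩ := htouch x hx hne
    rw [hbranch x hx hne] at hy
    exact hy ▸ huy
  have hnbr : ∀ x, (cycG G J).Reachable x₀ x → x ≠ x₀ → ∀ y, G.Adj x y →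
      y = u ∨ (cycG G J).Adj x y := by
    intro x hx hne y hxy
    by_cases hyJ : y ∈ J
    · exact .inl (hO.nbr_unique (hx0.of_reachable hx) huJ hyJ (hadj x hx hne).symm hxy)
    · rcases adj_cases (core_adj.2 ⟨hxy, (hx0.of_reachable hx).notMem, hyJ⟩) with h | h
      · exact .inr h
      · have : y ∈ branch G J x := h.reachable
        rw [hbranch x hx hne] at this
        exact absurd this.symm h.ne
  obtain ⟨w, hw⟩ : ∃ w, (brG G J).Adj x₀ w := by
    have : ∃ w, (brG G J).Reachable x₀ w ∧ w ≠ x₀ := by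
      by_contra! h
      exact hnl ⟨hx0, fun w hw _ => h w hw⟩
    obtain ⟨w, hw, hne⟩ := this
    exact exists_adj_of_reachable_ne hw hne.symm
  have hwn : ∀ c, (cycG G J).Adj x₀ c → c ≠ w := by
    rintro c hc rfl
    exact hw.2 hc.2
  have hn0 : ∀ y, G.Adj x₀ y ↔ y = x₁ ∨ y = x₂ ∨ y = w := by
    intro y
    refine ⟨hO.fourth h01.1.1 h02.1.1 hw.1.1 h12 (hwn _ h01) (hwn _ h02), ?_⟩
    rintro (rfl | rfl | rfl)
    · exact h01.1.1
    · exact h02.1.1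
    · exact hw.1.1
  have hux1 := hadj x₁ h01.reachable h01.ne.symm
  have hux2 := hadj x₂ h02.reachable h02.ne.symm
  obtain ⟨z, huz, hz1, hz2⟩ := hO.third hux1 hux2 h12
  by_cases hz : (cycG G J).Reachable x₀ z
  · obtain ⟨a, b, c, d, hab, ha, hb, hcd, hc, hd, hne⟩ := hO.cut
      (insert u {x | (cycG G J).Reachable x₀ x}) ⟨u, by simp⟩
      ⟨v, by
        rintro (rfl | h)
        · exact hv.notMem huJ
        · exact hvx h⟩
    have key : ∀ a b, G.Adj a b → a ∈ insert u {x | (cycG G J).Reachable x₀ x} →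
        b ∉ insert u {x | (cycG G J).Reachable x₀ x} → a = x₀ ∧ b = w := by
      intro a b hab ha hb
      have hb1 : b ≠ u := fun h => hb (.inl h)
      have hb2 : ¬ (cycG G J).Reachable x₀ b := fun h => hb (.inr h)
      rcases ha with rfl | ha
      · rcases hO.fourth hux1 hux2 huz h12 hz1 hz2 hab with rfl | rfl | rfl
        · exact absurd h01.reachable hb2
        · exact absurd h02.reachable hb2
        · exact absurd hz hb2
      · by_cases hax : a = x₀
        · subst hax
          rcases (hn0 b).1 hab with rfl | rfl | rfl
          · exact absurd h01.reachable hb2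
          · exact absurd h02.reachable hb2
          · exact ⟨rfl, rfl⟩
        · rcases hnbr a ha hax b hab with h | h
          · exact absurd h hb1
          · exact absurd (SimpleGraph.Reachable.trans ha h.reachable) hb2
    obtain ⟨rfl, rfl⟩ := key a b hab ha hb
    obtain ⟨rfl, rfl⟩ := key c d hcd hc hd
    simp at hne
  · have hC : ∀ y, (cycG G J).Reachable x₀ y → y = x₀ ∨ y = x₁ ∨ y = x₂ := by
      intro y hy
      by_cases hne : y = x₀
      · exact .inl hne
      rcases hO.fourth hux1 hux2 huz h12 hz1 hz2 (hadj y hy hne) with h | h | rfl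
      · exact .inr (.inl h)
      · exact .inr (.inr h)
      · exact absurd hy hz
    refine hO.not_exchange (u := u) (w := w) (z := z) hl1 h01.symm h02
      (hbranch x₁ h01.reachable h01.ne.symm) h12
      huJ hux2 huz hz1.symm hz2.symm hw.1.2.2 ?_ hn0 ?_ ?_ ?_
    · intro h
      rcases hC w (h01.reachable.trans h) with h' | h' | h'
      · exact hw.ne h'.symm
      · exact hwn _ h01 h'.symm
      · exact hwn _ h02 h'.symm
    · intro y hy
      rcases hnbr x₁ h01.reachable h01.ne.symm y hy with h | h
      · exact .inl h
      · rcases hC y (h01.reachable.trans h.reachable) with h' | h' | h'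
        · exact .inr (.inl h')
        · exact absurd h' h.ne.symm
        · exact .inr (.inr h')
    · intro y hy
      rcases hnbr x₂ h02.reachable h02.ne.symm y hy with h | h
      · exact .inl h
      · rcases hC y (h02.reachable.trans h.reachable) with h' | h' | h'
        · exact .inr (.inl h')
        · exact .inr (.inr h')
        · exact absurd h' h.ne.symm
    · intro y hy
      exact hC y (h01.reachable.trans hy)

/-- If `G - J` has another cycle, the number of vertices owned by a given cycle plus the number
of its vertices that are not light is at least three. -/
lemma IsOptimal.three_le_owns [Finite V] (hO : IsOptimal G J) (hv : Cyc G J v)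
    (hw : Cyc G J w) (hvw : ¬ (cycG G J).Reachable v w) :
    3 ≤ {u | Owns G J u ((cycG G J).connectedComponentMk v)}.ncard +
      {x | (cycG G J).Reachable v x ∧ ¬ Light G J x}.ncard := by
  by_contra! hlt
  obtain ⟨x₀, hvx, hnl⟩ := hO.exists_not_light hv hw hvw
  have hx0 := hv.of_reachable hvx
  have hmk : (cycG G J).connectedComponentMk v = (cycG G J).connectedComponentMk x₀ :=
    SimpleGraph.ConnectedComponent.eq.2 hvx
  have h0w : ¬ (cycG G J).Reachable x₀ w := fun h => hvw (hvx.trans h)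
  set A := {u | Owns G J u ((cycG G J).connectedComponentMk v)} with hA
  set B := {x | (cycG G J).Reachable v x ∧ ¬ Light G J x} with hB
  have hB1 : 1 ≤ B.ncard := (Set.ncard_pos).2 ⟨x₀, hvx, hnl⟩
  obtain ⟨x₁, x₂, h12, h01, h02, hx0n⟩ := hO.two hx0
  have hlight : ∃ x, (cycG G J).Reachable v x ∧ Light G J x := by
    by_contra! h
    have hsub : ({x₀, x₁, x₂} : Set V) ⊆ B := by
      rintro x (rfl | rfl | rfl)
      · exact ⟨hvx, hnl⟩
      · exact ⟨hvx.trans h01.reachable, h _ (hvx.trans h01.reachable)⟩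
      · exact ⟨hvx.trans h02.reachable, h _ (hvx.trans h02.reachable)⟩
    have := Set.ncard_le_ncard hsub
    rw [Set.ncard_eq_three.2 ⟨x₀, x₁, x₂, h01.ne, h02.ne, h12, rfl⟩] at this
    omega
  obtain ⟨x, hx, hxl⟩ := hlight
  obtain ⟨u, hu, -⟩ := hO.served hxl
  have hA1 : 1 ≤ A.ncard := (Set.ncard_pos).2 ⟨u, by
    rwa [hA, Set.mem_ofPred_eq, SimpleGraph.ConnectedComponent.eq.2 hx]⟩
  have hA' : A.ncard ≤ 1 := by omega
  have hB' : B.ncard ≤ 1 := by omega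
  rw [Set.ncard_le_one] at hA' hB'
  refine hO.not_owns_one hx0 hw h0w hnl ?_ ?_
  · intro y hy hne
    by_contra h
    exact hne (hB' y ⟨hvx.trans hy, h⟩ x₀ ⟨hvx, hnl⟩)
  · rw [← hmk]
    exact fun a b ha hb => hA' a ha b hb

end Claim

section Counting

variable {V : Type*} [Fintype V] {G : SimpleGraph V} {J : Finset V}

/-- A finite graph has at least as many edges as vertices that are not chosen representatives of
the connected components. -/
lemma card_le_edges_add_components (H : SimpleGraph V) :
    Fintype.card V ≤ H.edgeFinset.card + Fintype.card H.ConnectedComponent := by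
  let r : V → V := fun v => (H.connectedComponentMk v).out
  have hr : ∀ v, H.Reachable v (r v) := fun v =>
    (SimpleGraph.ConnectedComponent.eq.1 (Quot.out_eq (H.connectedComponentMk v))).symm
  have hstep : ∀ v, v ≠ r v → ∃ w, H.Adj v w ∧ H.dist w (r v) < H.dist v (r v) := by
    intro v hv
    obtain ⟨p, hp⟩ := (hr v).exists_walk_length_eq_dist
    generalize r v = t at *
    cases p with
    | nil => exact absurd rfl hv
    | @cons _ w _ h p =>
      refine ⟨w, h, ?_⟩
      have := SimpleGraph.dist_le p
      rw [SimpleGraph.Walk.length_cons] at hp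
      omega
  choose! f hf using hstep
  have hrep : (Finset.univ.filter fun v => ¬ v ≠ r v).card ≤
      Fintype.card H.ConnectedComponent := by
    refine Finset.card_le_card_of_injOn H.connectedComponentMk (fun _ _ => Finset.mem_univ _) ?_
    intro v hv w hw h
    simp only [Finset.coe_filter, Finset.mem_univ, true_and, Set.mem_ofPred_eq, not_not] at hv hw
    rw [hv, hw]
    exact congrArg (fun C : H.ConnectedComponent => C.out) h
  have hnon : (Finset.univ.filter fun v => v ≠ r v).card ≤ H.edgeFinset.card := by
    refine Finset.card_le_card_of_injOn (fun v => s(v, f v)) ?_ ?_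
    · intro v hv
      simp only [Finset.coe_filter, Finset.mem_univ, true_and, Set.mem_ofPred_eq] at hv
      simpa using (hf v hv).1
    · intro v hv w hw h
      simp only [Finset.coe_filter, Finset.mem_univ, true_and, Set.mem_ofPred_eq] at hv hw
      by_contra hne
      rcases Sym2.eq_iff.1 h with ⟨h1, -⟩ | ⟨h1, h2⟩
      · exact hne h1
      · have hrr : r v = r w := by
          have : H.connectedComponentMk v = H.connectedComponentMk w :=
            SimpleGraph.ConnectedComponent.eq.2 (h2 ▸ (hf v hv).1.reachable)
          exact congrArg (fun C : H.ConnectedComponent => C.out) this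
        have e1 := (hf v hv).2
        have e2 := (hf w hw).2
        rw [h2] at e1
        rw [← h1, ← hrr] at e2
        omega
  have := Finset.card_filter_add_card_filter_not (s := (Finset.univ : Finset V))
    (fun v => v ≠ r v)
  rw [Finset.card_univ] at this
  omega

/-- If every component of `H` has total weight at least `m`, then `m` times the number of
components is at most the total weight. -/
lemma components_mul_le (H : SimpleGraph V) (m : ℕ) (f : V → ℕ)
    (h : ∀ x, m ≤ ∑ v with H.Reachable v x, f v) :
    Fintype.card H.ConnectedComponent * m ≤ ∑ v, f v := by
  rw [← Finset.sum_fiberwise (s := Finset.univ) (g := H.connectedComponentMk) (f := f),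
    ← Finset.card_univ, ← smul_eq_mul]
  refine Finset.card_nsmul_le_sum _ _ _ fun C _ => ?_
  induction C using SimpleGraph.ConnectedComponent.ind with
  | _ x => simpa only [SimpleGraph.ConnectedComponent.eq] using h x

lemma IsCubicTwoEdgeConn.card_nbrs (hG : IsCubicTwoEdgeConn G) (v : V) :
    (Finset.univ.filter fun w => G.Adj v w).card = 3 := by
  obtain ⟨a, b, c, hab, hac, hbc, h⟩ := hG.three v
  rw [Finset.card_eq_three]
  refine ⟨a, b, c, hab, hac, hbc, ?_⟩
  ext w
  simp [h]

/-- The number of bridges of `G - J`. -/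
lemma IsOptimal.two_mul_bridges (hO : IsOptimal G J) :
    2 * (brG G J).edgeFinset.card + 2 * (Finset.univ.filter fun v => Cyc G J v).card +
      6 * J.card ≤ 3 * Fintype.card V := by
  have hdeg : ∀ v, (brG G J).degree v + (if Cyc G J v then 2 else 0) +
      (J.filter fun u => G.Adj v u).card + (if v ∈ J then 3 else 0) ≤ 3 := by
    intro v
    by_cases hv : v ∈ J
    · have h1 : (brG G J).degree v = 0 := by
        rw [SimpleGraph.degree, Finset.card_eq_zero, Finset.eq_empty_iff_forall_notMem]
        intro w hw
        rw [SimpleGraph.mem_neighborFinset] at hw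
        exact hw.1.2.1 hv
      have h2 : (J.filter fun u => G.Adj v u).card = 0 := by
        rw [Finset.card_eq_zero, Finset.filter_eq_empty_iff]
        exact fun u hu => hO.indep v hv u hu
      have h3 : ¬ Cyc G J v := fun h => h.notMem hv
      simp [h1, h2, h3, hv]
    · have h1 : (if Cyc G J v then 2 else 0) ≤
          (Finset.univ.filter fun w => (cycG G J).Adj v w).card := by
        split_ifs with h
        · obtain ⟨c, d, hcd, hc, hd, -⟩ := hO.two h
          exact Finset.one_lt_card.2 ⟨c, by simpa using hc, d, by simpa using hd, hcd⟩
        · exact Nat.zero_le _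
      have hd1 : Disjoint ((brG G J).neighborFinset v)
          (Finset.univ.filter fun w => (cycG G J).Adj v w) := by
        rw [Finset.disjoint_left]
        intro w hw hw'
        rw [SimpleGraph.mem_neighborFinset] at hw
        rw [Finset.mem_filter] at hw'
        exact hw.2 hw'.2.2
      have hd2 : Disjoint ((brG G J).neighborFinset v ∪
          Finset.univ.filter fun w => (cycG G J).Adj v w) (J.filter fun u => G.Adj v u) := by
        rw [Finset.disjoint_left]
        intro w hw hw'
        rw [Finset.mem_union, SimpleGraph.mem_neighborFinset, Finset.mem_filter] at hw
        rw [Finset.mem_filter] at hw'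
        rcases hw with hw | hw
        · exact hw.1.2.2 hw'.1
        · exact hw.2.1.2.2 hw'.1
      have hsub : ((brG G J).neighborFinset v ∪
          Finset.univ.filter fun w => (cycG G J).Adj v w) ∪ (J.filter fun u => G.Adj v u) ⊆
          Finset.univ.filter fun w => G.Adj v w := by
        intro w hw
        simp only [Finset.mem_union, SimpleGraph.mem_neighborFinset, Finset.mem_filter,
          Finset.mem_univ, true_and] at hw ⊢
        rcases hw with (hw | hw) | hw
        · exact hw.1.1
        · exact hw.1.1
        · exact hw.2
      have := Finset.card_le_card hsub
      rw [Finset.card_union_of_disjoint hd2, Finset.card_union_of_disjoint hd1,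
        hO.card_nbrs, SimpleGraph.card_neighborFinset_eq_degree] at this
      simp only [hv, if_false]
      omega
  have hsum := Finset.sum_le_sum fun v (_ : v ∈ Finset.univ) => hdeg v
  have hJ : ∑ v, (J.filter fun u => G.Adj v u).card = 3 * J.card := by
    have h := Finset.sum_card_bipartiteAbove_eq_sum_card_bipartiteBelow (s := J)
      (t := Finset.univ) (fun u v => G.Adj v u)
    simp only [Finset.bipartiteAbove, Finset.bipartiteBelow] at h
    rw [← h, mul_comm, ← smul_eq_mul]
    refine Finset.sum_eq_card_nsmul fun u _ => ?_
    simpa only [SimpleGraph.adj_comm] using hO.card_nbrs u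
  simp only [Finset.sum_add_distrib, SimpleGraph.sum_degrees_eq_twice_card_edges, hJ,
    Finset.sum_const, Finset.card_univ, smul_eq_mul, ← Finset.sum_filter] at hsum
  simp only [Finset.filter_mem_eq_inter, Finset.univ_inter] at hsum
  omega

/-- The vertices of the cycles of `G - J` that are not light, together with four times `J`, are
at most as many as the vertices of `G`. -/
lemma IsOptimal.card_not_light_add (hO : IsOptimal G J) {x : V} (hx : Cyc G J x) :
    (Finset.univ.filter fun v => Cyc G J v ∧ ¬ Light G J v).card + 4 * J.card ≤
      Fintype.card V := by
  have h1 := card_le_edges_add_components (brG G J)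
  have h2 := hO.two_mul_bridges
  have h3 := components_mul_le (brG G J) 2
    (fun v => (if Cyc G J v then 1 else 0) + (if Light G J v then 1 else 0) +
      (if v ∈ J then 2 else 0)) (by
    intro y
    by_cases hy : y ∈ J
    · refine le_trans ?_ (Finset.single_le_sum (fun _ _ => Nat.zero_le _)
        (Finset.mem_filter.2 ⟨Finset.mem_univ y, .rfl⟩))
      simp [hy]
    · obtain ⟨z, hz, hyz, -⟩ := exists_cyc_bridge le_rfl (hO.conn y hy x hx.notMem) hx
      by_cases hl : Light G J z
      · refine le_trans ?_ (Finset.single_le_sum (fun _ _ => Nat.zero_le _)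
          (Finset.mem_filter.2 ⟨Finset.mem_univ z, hyz.symm⟩))
        simp [hz, hl]
      · obtain ⟨w, hzw, hw, hne⟩ : ∃ w, (brG G J).Reachable z w ∧ Cyc G J w ∧ w ≠ z := by
          by_contra! h
          exact hl ⟨hz, h⟩
        refine le_trans ?_ (Finset.sum_le_sum_of_subset (s := {z, w}) ?_)
        · rw [Finset.sum_pair hne.symm]
          simp only [hz, hw, if_true]
          omega
        · intro v hv
          rw [Finset.mem_insert, Finset.mem_singleton] at hv
          rw [Finset.mem_filter]
          rcases hv with rfl | rfl
          · exact ⟨Finset.mem_univ _, hyz.symm⟩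
          · exact ⟨Finset.mem_univ _, (hyz.trans hzw).symm⟩)
  have h4 := Finset.card_filter_add_card_filter_not
    (s := Finset.univ.filter fun v => Cyc G J v) (fun v => Light G J v)
  rw [Finset.filter_filter, Finset.filter_filter] at h4
  have h5 : (Finset.univ.filter fun v => Cyc G J v ∧ Light G J v) =
      Finset.univ.filter fun v => Light G J v :=
    Finset.filter_congr fun v _ => ⟨fun h => h.2, fun h => ⟨h.1, h⟩⟩
  rw [h5] at h4
  simp only [Finset.sum_add_distrib, Finset.sum_const, smul_eq_mul, ← Finset.sum_filter,
    Finset.filter_mem_eq_inter, Finset.univ_inter] at h3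
  omega

/-- The bound on `J` when `G - J` is a tree. -/
lemma IsOptimal.card_of_no_cyc (hO : IsOptimal G J) (h : ∀ x, ¬ Cyc G J x) :
    4 * J.card ≤ Fintype.card V + 2 := by
  have h1 := card_le_edges_add_components (brG G J)
  have h2 := hO.two_mul_bridges
  have h3 : Fintype.card (brG G J).ConnectedComponent ≤ J.card + 1 := by
    by_cases hJ : ∃ x, x ∉ J
    · obtain ⟨x, hx⟩ := hJ
      have := components_mul_le (brG G J) 1
        (fun v => (if v ∈ J then 1 else 0) + (if v = x then 1 else 0)) (by
        intro y
        by_cases hy : y ∈ J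
        · refine le_trans ?_ (Finset.single_le_sum (fun _ _ => Nat.zero_le _)
            (Finset.mem_filter.2 ⟨Finset.mem_univ y, .rfl⟩))
          simp [hy]
        · have hxy : (brG G J).Reachable x y := by
            refine (hO.conn x hx y hy).mono ?_
            intro s t hst
            exact (adj_cases hst).resolve_left fun h' => h s (cyc_left h')
          refine le_trans ?_ (Finset.single_le_sum (fun _ _ => Nat.zero_le _)
            (Finset.mem_filter.2 ⟨Finset.mem_univ x, hxy⟩))
          simp)
      simp only [Finset.sum_add_distrib, Finset.sum_const, smul_eq_mul, ← Finset.sum_filter,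
        Finset.filter_mem_eq_inter, Finset.univ_inter] at this
      have hx1 : (Finset.univ.filter fun v => v = x).card = 1 :=
        Finset.card_eq_one.2 ⟨x, by ext; simp⟩
      omega
    · push Not at hJ
      have := components_mul_le (brG G J) 1 (fun v => if v ∈ J then 1 else 0) (by
        intro y
        refine le_trans ?_ (Finset.single_le_sum (fun _ _ => Nat.zero_le _)
          (Finset.mem_filter.2 ⟨Finset.mem_univ y, .rfl⟩))
        simp [hJ y])
      simp only [Finset.sum_const, smul_eq_mul, ← Finset.sum_filter,
        Finset.filter_mem_eq_inter, Finset.univ_inter] at this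
      omega
  omega

/-- The cycles of `G - J`. -/
noncomputable def cycles (G : SimpleGraph V) (J : Finset V) :
    Finset (cycG G J).ConnectedComponent :=
  (Finset.univ.filter fun v => Cyc G J v).image (cycG G J).connectedComponentMk

lemma sum_card_le_of_unique {α β : Type*} (S : Finset α) (T : Finset β) (r : α → β → Prop)
    (h : ∀ a b c, r a b → r a c → b = c) : ∑ b ∈ T, (S.filter fun a => r a b).card ≤ S.card := by
  have := Finset.sum_card_bipartiteAbove_eq_sum_card_bipartiteBelow (s := S) (t := T) r
  simp only [Finset.bipartiteAbove, Finset.bipartiteBelow] at this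
  rw [← this, Finset.card_eq_sum_ones]
  refine Finset.sum_le_sum fun a _ => ?_
  rw [Finset.card_le_one]
  intro b hb c hc
  exact h a b c (Finset.mem_filter.1 hb).2 (Finset.mem_filter.1 hc).2

lemma IsOptimal.three_mul_cycles (hO : IsOptimal G J) (h : 2 ≤ (cycles G J).card) :
    3 * (cycles G J).card ≤ J.card +
      (Finset.univ.filter fun v => Cyc G J v ∧ ¬ Light G J v).card := by
  have h1 := sum_card_le_of_unique J (cycles G J) (fun u C => Owns G J u C)
    fun u C D hC hD => hO.owns_unique hC hD
  have h2 := sum_card_le_of_unique (Finset.univ.filter fun v => Cyc G J v ∧ ¬ Light G J v)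
    (cycles G J) (fun v C => (cycG G J).connectedComponentMk v = C)
    fun v C D hC hD => hC.symm.trans hD
  refine le_trans ?_ (add_le_add h1 h2)
  rw [← Finset.sum_add_distrib, mul_comm, ← smul_eq_mul]
  refine Finset.card_nsmul_le_sum _ _ _ fun C hC => ?_
  obtain ⟨D, hD, hDC⟩ := Finset.exists_mem_ne h C
  simp only [cycles, Finset.mem_image, Finset.mem_filter, Finset.mem_univ, true_and] at hC hD
  obtain ⟨v, hv, rfl⟩ := hC
  obtain ⟨w, hw, rfl⟩ := hD
  have hvw : ¬ (cycG G J).Reachable v w := fun h =>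
    hDC (SimpleGraph.ConnectedComponent.eq.2 h.symm)
  refine (hO.three_le_owns hv hw hvw).trans (add_le_add (le_of_eq ?_) (le_of_eq ?_))
  · rw [← Set.ncard_coe_finset]
    congr 1
    ext u
    simpa using fun h => Owns.mem h
  · rw [← Set.ncard_coe_finset]
    congr 1
    ext x
    simp only [Set.mem_ofPred_eq, Finset.coe_filter, Finset.mem_filter, Finset.mem_univ,
      true_and, SimpleGraph.ConnectedComponent.eq]
    exact ⟨fun h => ⟨⟨hv.of_reachable h.1, h.2⟩, h.1.symm⟩, fun h => ⟨h.2.symm, h.1.2⟩⟩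

lemma IsOptimal.three_mul_le (hO : IsOptimal G J) (hcard : 10 ≤ Fintype.card V) :
    3 * (J.card + (cycles G J).card) ≤ Fintype.card V := by
  by_cases h : ∃ x, Cyc G J x
  · obtain ⟨x, hx⟩ := h
    have h1 := hO.card_not_light_add hx
    by_cases h2 : 2 ≤ (cycles G J).card
    · have := hO.three_mul_cycles h2
      omega
    · omega
  · push Not at h
    have h1 := hO.card_of_no_cyc h
    have h2 : (cycles G J).card = 0 := by
      rw [Finset.card_eq_zero, cycles, Finset.image_eq_empty, Finset.filter_eq_empty_iff]
      exact fun x _ => h x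
    omega

lemma IsCubicTwoEdgeConn.connOn_univ (hG : IsCubicTwoEdgeConn G) : ConnOn G Set.univ := by
  intro a ha b hb
  by_contra hab
  obtain ⟨x, y, -, -, hxy, hx, hy, -⟩ := hG.cut {v | (within G Set.univ).Reachable a v}
    ⟨a, .rfl⟩ ⟨b, hab⟩
  have : (within G Set.univ).Adj x y := ⟨hxy, trivial, trivial⟩
  exact hy (SimpleGraph.Reachable.trans hx this.reachable)

lemma IsCubicTwoEdgeConn.exists_isOptimal (hG : IsCubicTwoEdgeConn G) :
    ∃ J, IsOptimal G J := by
  have hle : ∀ J, cycNum G J ≤ Fintype.card V := fun J => by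
    rw [← Nat.card_eq_fintype_card, ← Set.ncard_univ]
    exact Set.ncard_le_ncard (Set.subset_univ _)
  obtain ⟨J, hJ, hmax⟩ := Set.exists_max_image {J : Finset V | IsNonseparating G J}
    (fun J => J.card * (Fintype.card V + 1) + cycNum G J) (Set.toFinite _)
    ⟨∅, by
      refine ⟨by simp, ?_⟩
      simpa using hG.connOn_univ⟩
  refine ⟨J, { toIsCubicTwoEdgeConn := hG, toIsNonseparating := hJ, max := ?_, max_cyc := ?_ }⟩
  · intro J' hJ'
    by_contra! hlt
    have h1 := hmax J' hJ'
    have h2 := hle J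
    have h3 : (J.card + 1) * (Fintype.card V + 1) ≤ J'.card * (Fintype.card V + 1) :=
      Nat.mul_le_mul_right _ hlt
    nlinarith
  · intro J' hJ' hcard
    have h1 := hmax J' hJ'
    simp only [hcard] at h1
    omega

end Counting

section Frustration

variable {V : Type*} {G K : SimpleGraph V} {J : Finset V} {σ τ : Sym2 V → Bool}

lemma sgnSwitch_mk (σ : Sym2 V → Bool) (X : Set V) (a b : V) :
    sgnSwitch σ X s(a, b) = xor (σ s(a, b)) (xor (decide (a ∈ X)) (decide (b ∈ X))) := rfl

lemma sgnSwitch_sgnSwitch (σ : Sym2 V → Bool) (X Y : Set V) :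
    sgnSwitch (sgnSwitch σ X) Y = sgnSwitch σ (symmDiff X Y) := by
  funext e
  induction e with
  | _ a b =>
    simp only [sgnSwitch_mk, Set.mem_symmDiff]
    by_cases h1 : a ∈ X <;> by_cases h2 : a ∈ Y <;> by_cases h3 : b ∈ X <;>
      by_cases h4 : b ∈ Y <;> simp [h1, h2, h3, h4]

/-- The graph of the positive edges of `K`. -/
def posG (K : SimpleGraph V) (τ : Sym2 V → Bool) : SimpleGraph V :=
  K.deleteEdges {e | τ e = true}

lemma posG_adj {a b : V} : (posG K τ).Adj a b ↔ K.Adj a b ∧ τ s(a, b) = false := by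
  simp [posG, SimpleGraph.deleteEdges_adj]

/-- In a signature with as few negative edges as possible, the positive edges connect the ends
of every edge. -/
lemma posG_reachable [Finite V] (hmin : ∀ Y, negNum K τ ≤ negNum K (sgnSwitch τ Y)) {a b : V}
    (hab : K.Adj a b) : (posG K τ).Reachable a b := by
  by_contra hnot
  refine (hmin {v | (posG K τ).Reachable a v}).not_gt ?_
  have hneg : τ s(a, b) = true := by
    by_contra h
    exact hnot (posG_adj.2 ⟨hab, by simpa using h⟩).reachable
  refine Set.ncard_lt_ncard ?_ (Set.toFinite _)
  rw [Set.ssubset_iff_of_subset]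
  · refine ⟨s(a, b), ⟨hab, hneg⟩, fun h => ?_⟩
    have h2 := h.2
    rw [sgnSwitch_mk, decide_eq_true (p := a ∈ {v | (posG K τ).Reachable a v}) .rfl,
      decide_eq_false (p := b ∈ {v | (posG K τ).Reachable a v}) hnot, hneg] at h2
    simp at h2
  · intro e
    induction e with
    | _ x y =>
      rintro ⟨hxy, h⟩
      refine ⟨hxy, ?_⟩
      by_contra h'
      have hpos : (posG K τ).Adj x y := posG_adj.2 ⟨hxy, by simpa using h'⟩
      have hiff : x ∈ {v | (posG K τ).Reachable a v} ↔ y ∈ {v | (posG K τ).Reachable a v} :=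
        ⟨fun hx => SimpleGraph.Reachable.trans hx hpos.reachable,
          fun hy => SimpleGraph.Reachable.trans hy hpos.symm.reachable⟩
      rw [sgnSwitch_mk, Bool.eq_false_iff.2 h'] at h
      simp [hiff] at h

lemma posG_le_delete {a b : V} (h : τ s(a, b) = true) :
    posG K τ ≤ K.deleteEdges {s(a, b)} :=
  SimpleGraph.deleteEdges_anti (by simpa using h)

lemma negative_mem_cycG [Finite V] (hmin : ∀ Y, negNum K τ ≤ negNum K (sgnSwitch τ Y)) {a b : V}
    (hab : K.Adj a b) (h : τ s(a, b) = true) : (cyclicPart K).Adj a b :=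
  ⟨hab, (posG_reachable hmin hab).mono (posG_le_delete h)⟩

/-- In an optimal signature of `G - J`, every cycle contains at most one negative edge. -/
lemma IsOptimal.negative_unique [Finite V] (hO : IsOptimal G J)
    (hmin : ∀ Y, negNum (core G J) τ ≤ negNum (core G J) (sgnSwitch τ Y)) {a b c d : V}
    (hab : (core G J).Adj a b) (hcd : (core G J).Adj c d) (h1 : τ s(a, b) = true)
    (h2 : τ s(c, d) = true) (hac : (cycG G J).Reachable a c) : s(a, b) = s(c, d) := by
  by_contra hne
  have hK1 : (cyclicPart ((core G J).deleteEdges {s(a, b)})).Adj c d := by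
    refine ⟨delete_adj.2 ⟨hcd, fun h => hne h.symm⟩, (posG_reachable hmin hcd).mono ?_⟩
    intro x y hxy
    exact delete_adj.2 ⟨posG_le_delete h1 hxy, (delete_adj.1 (posG_le_delete h2 hxy)).2⟩
  have hle : cyclicPart ((core G J).deleteEdges {s(a, b)}) ≤ cycG G J :=
    cyclicPart_mono (SimpleGraph.deleteEdges_le _)
  refine reach_inv (fun v => ∀ w, ¬ (cyclicPart ((core G J).deleteEdges {s(a, b)})).Adj v w)
    ?_ hac ?_ d hK1
  · intro v w hvw hv x hwx
    obtain ⟨y, hyx, hwy⟩ := exists_second hwx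
    obtain ⟨p, q, -, -, -, hpq⟩ := hO.two (cyc_right hvw)
    have e1 := hpq x (hle hwx)
    have e2 := hpq y (hle hwy)
    have e3 := hpq v hvw.symm
    have : v = x ∨ v = y := by grind
    rcases this with rfl | rfl
    · exact hv w hwx.symm
    · exact hv w hwy.symm
  · intro x hax
    obtain ⟨y, hyx, hay⟩ := exists_second hax
    have hb := negative_mem_cycG hmin hab h1
    obtain ⟨p, q, -, -, -, hpq⟩ := hO.two (cyc_left hb)
    have e1 := hpq x (hle hax)
    have e2 := hpq y (hle hay)
    have e3 := hpq b hb
    have hxb : x ≠ b := by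
      rintro rfl
      exact (delete_adj.1 hax.1).2 rfl
    have hyb : y ≠ b := by
      rintro rfl
      exact (delete_adj.1 hay.1).2 rfl
    grind

lemma IsOptimal.negNum_core_le [Fintype V] (hO : IsOptimal G J)
    (hmin : ∀ Y, negNum (core G J) τ ≤ negNum (core G J) (sgnSwitch τ Y)) :
    negNum (core G J) τ ≤ (cycles G J).card := by
  have hg : ∀ e : Sym2 V, ∃ p : V × V, s(p.1, p.2) = e := fun e => by
    induction e with
    | _ a b => exact ⟨(a, b), rfl⟩
  choose g hg using hg
  rw [negNum, ← Set.ncard_coe_finset]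
  refine Set.ncard_le_ncard_of_injOn (fun e => (cycG G J).connectedComponentMk (g e).1) ?_ ?_
    (Set.toFinite _)
  · rintro e ⟨he, hneg⟩
    rw [← hg e] at he hneg
    refine Finset.mem_coe.2 (Finset.mem_image_of_mem _ ?_)
    rw [Finset.mem_filter]
    exact ⟨Finset.mem_univ _, cyc_left (negative_mem_cycG hmin he hneg)⟩
  · rintro e ⟨he, hneg⟩ f ⟨hf, hnegf⟩ hef
    rw [← hg e] at he hneg
    rw [← hg f] at hf hnegf
    rw [← hg e, ← hg f]
    exact hO.negative_unique hmin he hf hneg hnegf (SimpleGraph.ConnectedComponent.eq.1 hef)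

/-- Switching a vertex that is incident with two negative edges of a cubic graph decreases the
number of negative edges. -/
lemma IsCubicTwoEdgeConn.negNum_switch_lt [Finite V] (hG : IsCubicTwoEdgeConn G) {u x y : V}
    (hx : G.Adj u x) (hy : G.Adj u y) (hxy : x ≠ y) (h1 : τ s(u, x) = true)
    (h2 : τ s(u, y) = true) : negNum G (sgnSwitch τ {u}) < negNum G τ := by
  obtain ⟨z, hz, hxz, hyz⟩ := hG.third hx hy hxy
  set A := {e | e ∈ G.edgeSet ∧ τ e = true} with hA
  have hsub : {e | e ∈ G.edgeSet ∧ sgnSwitch τ {u} e = true} ⊆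
      insert s(u, z) ((A \ {s(u, x)}) \ {s(u, y)}) := by
    have key : ∀ w, G.Adj u w → sgnSwitch τ {u} s(u, w) = true →
        s(u, w) ∈ insert s(u, z) ((A \ {s(u, x)}) \ {s(u, y)}) := by
      intro w hw h
      rw [sgnSwitch_mk] at h
      have hwu : w ≠ u := hw.ne.symm
      rcases hG.fourth hx hy hz hxy hxz hyz hw with rfl | rfl | rfl
      · simp [h1, hwu] at h
      · simp [h2, hwu] at h
      · exact .inl rfl
    intro e
    induction e with
    | _ a b =>
      rintro ⟨hab, h⟩
      rw [SimpleGraph.mem_edgeSet] at hab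
      by_cases ha : a = u
      · subst ha
        exact key b hab h
      by_cases hb : b = u
      · subst hb
        rw [Sym2.eq_swap (a := a)] at h ⊢
        exact key a hab.symm h
      · refine .inr ⟨⟨⟨hab, ?_⟩, ?_⟩, ?_⟩
        · simpa [sgnSwitch_mk, ha, hb] using h
        · simp [ha, hb]
        · simp [ha, hb]
  have hxA : s(u, x) ∈ A := ⟨hx, h1⟩
  have hyA : s(u, y) ∈ A \ {s(u, x)} := ⟨⟨hy, h2⟩, by
    intro h
    rcases Sym2.eq_iff.1 h with ⟨-, h⟩ | ⟨h, -⟩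
    · exact hxy h.symm
    · exact hx.ne h⟩
  have e1 := Set.ncard_sdiff_singleton_add_one hxA (Set.toFinite _)
  have e2 := Set.ncard_sdiff_singleton_add_one hyA (Set.toFinite _)
  have e3 := (Set.ncard_le_ncard hsub (Set.toFinite _)).trans (Set.ncard_insert_le _ _)
  change Set.ncard _ < Set.ncard A
  omega

lemma negNum_core_switch {u : V} (hu : u ∈ J) :
    negNum (core G J) (sgnSwitch τ {u}) = negNum (core G J) τ := by
  unfold negNum
  congr 1
  ext e
  induction e with
  | _ a b =>
    refine and_congr_right fun h => ?_
    rw [SimpleGraph.mem_edgeSet, core_adj] at h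
    have ha : a ≠ u := fun h' => h.2.1 (h' ▸ hu)
    have hb : b ≠ u := fun h' => h.2.2 (h' ▸ hu)
    simp [sgnSwitch_mk, ha, hb]

lemma negNum_le_core_add [Fintype V]
    (h : ∀ u ∈ J, ∀ x y, G.Adj u x → G.Adj u y → τ s(u, x) = true → τ s(u, y) = true → x = y) :
    negNum G τ ≤ negNum (core G J) τ + J.card := by
  let f : V → Sym2 V := fun u =>
    if h : ∃ x, G.Adj u x ∧ τ s(u, x) = true then s(u, h.choose) else s(u, u)
  have hf : ∀ u ∈ J, ∀ x, G.Adj u x → τ s(u, x) = true → f u = s(u, x) := by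
    intro u hu x hx hneg
    have hex : ∃ x, G.Adj u x ∧ τ s(u, x) = true := ⟨x, hx, hneg⟩
    simp only [f, dif_pos hex]
    rw [h u hu _ _ hex.choose_spec.1 hx hex.choose_spec.2 hneg]
  have hsub : {e | e ∈ G.edgeSet ∧ τ e = true} ⊆
      {e | e ∈ (core G J).edgeSet ∧ τ e = true} ∪ f '' J := by
    intro e
    induction e with
    | _ a b =>
      rintro ⟨hab, hneg⟩
      rw [SimpleGraph.mem_edgeSet] at hab
      by_cases ha : a ∈ J
      · exact .inr ⟨a, ha, hf a ha b hab hneg⟩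
      by_cases hb : b ∈ J
      · rw [Sym2.eq_swap] at hneg ⊢
        exact .inr ⟨b, hb, hf b hb a hab.symm hneg⟩
      · exact .inl ⟨core_adj.2 ⟨hab, ha, hb⟩, hneg⟩
  have e1 := (Set.ncard_le_ncard hsub (Set.toFinite _)).trans (Set.ncard_union_le _ _)
  have e2 := Set.ncard_image_le (f := f) (s := (J : Set V)) (Set.toFinite _)
  rw [Set.ncard_coe_finset] at e2
  unfold negNum
  omega

lemma IsOptimal.frust_le [Fintype V] (hO : IsOptimal G J) (σ : Sym2 V → Bool) :
    frust G σ ≤ J.card + (cycles G J).card := by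
  obtain ⟨X₀, hX₀⟩ := Finite.exists_min fun X => negNum (core G J) (sgnSwitch σ X)
  obtain ⟨X, hX, hmin⟩ := Set.exists_min_image
    {X | ∀ Y, negNum (core G J) (sgnSwitch σ X) ≤ negNum (core G J) (sgnSwitch σ Y)}
    (fun X => negNum G (sgnSwitch σ X)) (Set.toFinite _) ⟨X₀, hX₀⟩
  have h1 : ∀ Y, negNum (core G J) (sgnSwitch σ X) ≤
      negNum (core G J) (sgnSwitch (sgnSwitch σ X) Y) := fun Y => by
    rw [sgnSwitch_sgnSwitch]
    exact hX _
  have h2 : negNum G (sgnSwitch σ X) ≤ negNum (core G J) (sgnSwitch σ X) + J.card := by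
    refine negNum_le_core_add fun u hu x y hx hy hnx hny => ?_
    by_contra hxy
    refine (hO.negNum_switch_lt hx hy hxy hnx hny).not_ge ?_
    rw [sgnSwitch_sgnSwitch]
    refine hmin _ fun Y => ?_
    rw [← sgnSwitch_sgnSwitch, negNum_core_switch hu]
    exact hX Y
  have h3 : frust G σ ≤ negNum G (sgnSwitch σ X) := ciInf_le (OrderBot.bddBelow _) X
  have h4 := hO.negNum_core_le h1
  omega

lemma isCubicTwoEdgeConn [Finite V] (h2ec : TwoEdgeConn G)
    (hcubic : ∀ v : V, (G.neighborSet v).ncard = 3) : IsCubicTwoEdgeConn G := by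
  refine ⟨fun v => ?_, fun X hX hXc => ?_⟩
  · obtain ⟨a, b, c, hab, hac, hbc, h⟩ := Set.ncard_eq_three.1 (hcubic v)
    refine ⟨a, b, c, hab, hac, hbc, fun w => ?_⟩
    rw [← SimpleGraph.mem_neighborSet, h]
    simp
  · have horient : ∀ e : Sym2 V, e ∈ G.edgeSet → sgnCross X e = true →
        ∃ a b, e = s(a, b) ∧ G.Adj a b ∧ a ∈ X ∧ b ∉ X := by
      intro e
      induction e with
      | _ a b =>
        intro hab h
        change xor (decide (a ∈ X)) (decide (b ∈ X)) = true at h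
        rw [SimpleGraph.mem_edgeSet] at hab
        by_cases ha : a ∈ X
        · by_cases hb : b ∈ X
          · simp [ha, hb] at h
          · exact ⟨a, b, rfl, hab, ha, hb⟩
        · by_cases hb : b ∈ X
          · exact ⟨b, a, Sym2.eq_swap, hab.symm, hb, ha⟩
          · simp [ha, hb] at h
    obtain ⟨e, ⟨he, he'⟩, f, ⟨hf, hf'⟩, hef⟩ :=
      (Set.one_lt_ncard (Set.toFinite _)).1 (h2ec X hX hXc)
    obtain ⟨a, b, rfl, hab, ha, hb⟩ := horient e he he'
    obtain ⟨c, d, rfl, hcd, hc, hd⟩ := horient f hf hf'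
    refine ⟨a, b, c, d, hab, ha, hb, hcd, hc, hd, ?_⟩
    by_contra! h
    exact hef (by rw [h.1, h.2])

lemma IsCubicTwoEdgeConn.two_mul_ncard_edgeSet [Fintype V] (hG : IsCubicTwoEdgeConn G) :
    2 * G.edgeSet.ncard = 3 * Fintype.card V := by
  rw [← SimpleGraph.coe_edgeFinset, Set.ncard_coe_finset,
    ← SimpleGraph.sum_degrees_eq_twice_card_edges, mul_comm, ← smul_eq_mul, ← Finset.card_univ]
  refine Finset.sum_eq_card_nsmul fun v _ => ?_
  rw [← hG.card_nbrs v, ← SimpleGraph.card_neighborFinset_eq_degree]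
  congr 1
  ext w
  simp

end Frustration

end SignedCubic

/-- Every signed 2-edge-connected simple cubic graph on at least 10
vertices satisfies `F(G, σ) ≤ (2/9)·e(G)`. -/
theorem frust_le_two_ninths_edges {V : Type*} [Fintype V]
    (G : SimpleGraph V) (σ : Sym2 V → Bool)
    (h2ec : TwoEdgeConn G)
    (hcubic : ∀ v : V, (G.neighborSet v).ncard = 3)
    (hcard : 10 ≤ Fintype.card V) :
    9 * frust G σ ≤ 2 * G.edgeSet.ncard := by
  have hG := SignedCubic.isCubicTwoEdgeConn h2ec hcubic
  obtain ⟨J, hO⟩ := hG.exists_isOptimal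
  have h1 := hO.three_mul_le hcard
  have h2 := hO.frust_le σ
  have h3 := hG.two_mul_ncard_edgeSet
  omega
end

section
/- Every 2-edge-connected simple cubic graph G on at least 10 vertices contains an edge-cut of size at least (7/9)·e(G). -/
open scoped Classical

namespace SimpleGraph

variable {V α : Type*} {G : SimpleGraph V} {S : Finset V}

/-- The map `c` is a proper coloring of the subgraph of `G` induced on `S`. -/
def IsProperOn (G : SimpleGraph V) (c : V → α) (S : Finset V) : Prop :=
  ∀ u ∈ S, ∀ v ∈ S, G.Adj u v → c u ≠ c v

theorem IsProperOn.mono {c : V → α} {T : Finset V} (h : G.IsProperOn c S) (hT : T ⊆ S) :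
    G.IsProperOn c T :=
  fun u hu v hv => h u (hT hu) v (hT hv)

theorem IsProperOn.update {c : V → α} (h : G.IsProperOn c S) {v : V} (hv : v ∉ S) {a : α}
    (ha : ∀ u ∈ S, G.Adj v u → c u ≠ a) :
    G.IsProperOn (Function.update c v a) (insert v S) := by
  intro x hx y hy hxy
  have hne := hxy.ne
  rw [Finset.mem_insert] at hx hy
  rcases hx with rfl | hx <;> rcases hy with rfl | hy
  · exact absurd rfl hne
  · rw [Function.update_self, Function.update_of_ne hne.symm]
    exact (ha y hy hxy).symm
  · rw [Function.update_self, Function.update_of_ne hne]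
    exact ha x hx hxy.symm
  · rw [Function.update_of_ne (ne_of_mem_of_not_mem hx hv),
      Function.update_of_ne (ne_of_mem_of_not_mem hy hv)]
    exact h x hx y hy hxy

theorem IsProperOn.exists_insert [Fintype V] {k : ℕ} {c : V → Fin k} (h : G.IsProperOn c S) {v : V}
    (hv : v ∉ S) (hk : ((G.neighborFinset v ∩ S).image c).card < k) :
    ∃ c' : V → Fin k, G.IsProperOn c' (insert v S) ∧ ∀ u ∈ S, c' u = c u := by
  obtain ⟨a, -, ha⟩ := Finset.exists_mem_notMem_of_card_lt_card
    (s := (G.neighborFinset v ∩ S).image c) (t := Finset.univ) (by simpa using hk)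
  refine ⟨Function.update c v a, h.update hv ?_, ?_⟩
  · rintro u hu hvu rfl
    exact ha (Finset.mem_image_of_mem c (by simp [hu, hvu]))
  · intro u hu
    exact Function.update_of_ne (ne_of_mem_of_not_mem hu hv) _ _

/-- Greedy coloring along a path: every vertex of `L` is followed by a neighbor not yet colored. -/
theorem IsProperOn.exists_union_path [Fintype V] {k : ℕ} (hdeg : ∀ v, G.degree v ≤ k)
    (z : V) (L : List V) : ∀ {S : Finset V} {c : V → Fin k}, G.IsProperOn c S →
    (L ++ [z]).IsChain G.Adj → (L ++ [z]).Nodup → (∀ v ∈ L ++ [z], v ∉ S) →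
    ∃ c' : V → Fin k, G.IsProperOn c' (S ∪ L.toFinset) ∧ ∀ u ∈ S, c' u = c u := by
  induction L with
  | nil =>
    intro S c hc _ _ _
    exact ⟨c, by simpa using hc, fun _ _ => rfl⟩
  | cons u L ih =>
    intro S c hc hch hnd hS
    obtain ⟨w, hw, huw⟩ : ∃ w ∈ L ++ [z], G.Adj u w := by
      cases L with
      | nil => exact ⟨z, by simp, by simpa using hch⟩
      | cons w L => exact ⟨w, by simp, by simp at hch; exact hch.1⟩
    have hlt : ((G.neighborFinset u ∩ S).image c).card < k := by
      refine Finset.card_image_le.trans_lt (lt_of_lt_of_le (Finset.card_lt_card ?_) (hdeg u))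
      refine (Finset.ssubset_iff_of_subset Finset.inter_subset_left).2 ⟨w, by simpa using huw, ?_⟩
      have := hS w (by simp only [List.cons_append, List.mem_cons]; exact Or.inr hw)
      simp [this]
    obtain ⟨c₁, hc₁, he₁⟩ := hc.exists_insert (hS u (by simp)) hlt
    rw [List.cons_append, List.nodup_cons] at hnd
    obtain ⟨c₂, hc₂, he₂⟩ := ih hc₁ hch.tail hnd.2 (by
      intro v hv
      rw [Finset.mem_insert, not_or]
      exact ⟨fun e => hnd.1 (e ▸ hv), hS v (by
        rw [List.cons_append]; exact List.mem_cons_of_mem _ hv)⟩)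
    refine ⟨c₂, hc₂.mono ?_, fun v hv => ?_⟩
    · intro v; simp only [Finset.mem_union, List.toFinset_cons, Finset.mem_insert]; tauto
    · rw [he₂ v (Finset.mem_insert_of_mem hv), he₁ v hv]

/-- Greedy coloring along a path whose last vertex sees a repeated color. -/
theorem IsProperOn.exists_union_path_insert [Fintype V] {k : ℕ} (hdeg : ∀ v, G.degree v ≤ k)
    {z a b : V} {L : List V} {c : V → Fin k} (hc : G.IsProperOn c S)
    (hch : (L ++ [z]).IsChain G.Adj) (hnd : (L ++ [z]).Nodup) (hS : ∀ v ∈ L ++ [z], v ∉ S)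
    (ha : a ∈ S) (hb : b ∈ S) (hab : a ≠ b) (hcab : c a = c b) (hza : G.Adj z a)
    (hzb : G.Adj z b) :
    ∃ c' : V → Fin k, G.IsProperOn c' (insert z (S ∪ L.toFinset)) := by
  obtain ⟨c₁, hc₁, he⟩ := IsProperOn.exists_union_path hdeg z L hc hch hnd hS
  have hz : z ∉ S ∪ L.toFinset := by
    have := hS z (by simp)
    have hzL : z ∉ L := fun h => (List.nodup_append.1 hnd).2.2 z h z (by simp) rfl
    simp [this, hzL]
  have hlt : ((G.neighborFinset z ∩ (S ∪ L.toFinset)).image c₁).card < k := by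
    refine lt_of_lt_of_le ?_ ((Finset.card_le_card
      (Finset.inter_subset_left (s₂ := S ∪ L.toFinset))).trans (hdeg z))
    refine lt_of_le_of_ne Finset.card_image_le fun h => hab ?_
    exact Finset.card_image_iff.1 h (by simp [hza, ha]) (by simp [hzb, hb])
      (by rw [he a ha, he b hb, hcab])
  obtain ⟨c₂, hc₂, -⟩ := hc₁.exists_insert hz hlt
  exact ⟨c₂, hc₂⟩

/-- Any path can be prolonged at its head until it cannot be prolonged any further. -/
theorem exists_maximal_path (S : Finset V) (P : List V) (hch : P.IsChain G.Adj) (hnd : P.Nodup)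
    (hP : ∀ v ∈ P, v ∈ S) :
    ∃ Q : List V, (Q ++ P).IsChain G.Adj ∧ (Q ++ P).Nodup ∧ (∀ v ∈ Q ++ P, v ∈ S) ∧
      ∀ h ∈ (Q ++ P).head?, ∀ w ∈ S, G.Adj h w → w ∈ Q ++ P := by
  induction hn : S.card - P.length generalizing P with
  | zero =>
    refine ⟨[], hch, hnd, hP, fun h _ w hw _ => ?_⟩
    have : P.toFinset = S := Finset.eq_of_subset_of_card_le (fun v hv => hP v (by simpa using hv))
      (by rw [List.toFinset_card_of_nodup hnd]; omega)
    simpa [← this] using hw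
  | succ n ih =>
    by_cases hmax : ∀ h ∈ P.head?, ∀ w ∈ S, G.Adj h w → w ∈ P
    · exact ⟨[], hch, hnd, hP, hmax⟩
    · push Not at hmax
      obtain ⟨h, hh, w, hw, hhw, hwP⟩ := hmax
      obtain ⟨Q, h1, h2, h3, h4⟩ := ih (w :: P)
        (by
          rw [List.isChain_cons]
          refine ⟨fun y hy => ?_, hch⟩
          rw [Option.mem_unique hy hh]; exact hhw.symm)
        (by simp [hwP, hnd]) (by simpa [hw] using hP) (by simp; omega)
      refine ⟨Q ++ [w], ?_⟩
      rw [List.append_assoc]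
      exact ⟨h1, h2, h3, h4⟩

end SimpleGraph

theorem List.exists_eq_append_last {α : Type*} (p : α → Prop) (l : List α) (h : ∃ x ∈ l, p x) :
    ∃ A x B, l = A ++ x :: B ∧ p x ∧ ∀ y ∈ B, ¬ p y := by
  induction l with
  | nil => simp at h
  | cons a l ih =>
    by_cases hl : ∃ x ∈ l, p x
    · obtain ⟨A, x, B, rfl, hx, hB⟩ := ih hl
      exact ⟨a :: A, x, B, rfl, hx, hB⟩
    · push Not at hl
      obtain ⟨x, hx, hpx⟩ := h
      rcases List.mem_cons.1 hx with rfl | hx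
      · exact ⟨[], x, l, rfl, hpx, hl⟩
      · exact absurd hpx (hl x hx)

theorem List.exists_eq_append_switch {α : Type*} (p : α → Prop) (a : α) (l : List α) (ha : ¬ p a)
    (h : ∃ x ∈ l, p x) :
    ∃ A y x B, a :: l = A ++ y :: x :: B ∧ ¬ p y ∧ p x := by
  induction l generalizing a with
  | nil => simp at h
  | cons b l ih =>
    by_cases hb : p b
    · exact ⟨[], a, b, l, rfl, ha, hb⟩
    · obtain ⟨A, y, x, B, e, hy, hx⟩ := ih b hb (by
        obtain ⟨x, hx, hpx⟩ := h
        rcases List.mem_cons.1 hx with rfl | hx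
        · exact absurd hpx hb
        · exact ⟨x, hx, hpx⟩)
      exact ⟨a :: A, y, x, B, by rw [e]; rfl, hy, hx⟩

namespace SimpleGraph

variable {V : Type*} {G : SimpleGraph V} {S : Finset V}

/-- If a path inside `S` covers `S`, starts (from its far end) with `v₁, v₂, v₃` where `v₁` and `v₃`
are not adjacent, and `v₂` has a further neighbor in `S`, then `S` can be colored. -/
theorem exists_isProperOn_of_spanning_path [Fintype V] {k : ℕ} (hdeg : ∀ v, G.degree v ≤ k)
    (hk : 0 < k) {Q : List V} {v₁ v₂ v₃ u : V}
    (hch : (Q ++ [v₃, v₂, v₁]).IsChain G.Adj) (hnd : (Q ++ [v₃, v₂, v₁]).Nodup)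
    (hS : ∀ v ∈ S, v ∈ Q ++ [v₃, v₂, v₁]) (h13 : ¬ G.Adj v₁ v₃) (hu : u ∈ Q) (h2u : G.Adj v₂ u) :
    ∃ c : V → Fin k, G.IsProperOn c S := by
  obtain ⟨A, B, rfl⟩ := List.append_of_mem hu
  have hc₀ : G.IsProperOn (fun _ => (⟨0, hk⟩ : Fin k)) {v₁, v₃} := by
    intro x hx y hy hxy
    simp only [Finset.mem_insert, Finset.mem_singleton] at hx hy
    have := hxy.ne
    have := hxy.symm
    grind
  have hch1 : (A ++ u :: (B ++ [v₃, v₂, v₁])).IsChain G.Adj := by simpa using hch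
  rw [List.isChain_split] at hch1
  have hch2 : ((u :: B) ++ [v₃, v₂, v₁]).IsChain G.Adj := by simpa using hch1.2
  have hch3 : (u :: B).IsChain G.Adj := hch2.left_of_append
  have hch4 := List.isChain_reverse.2 (hch3.imp fun a b h => h.symm)
  have h32 : [v₃, v₂, v₁].IsChain G.Adj := hch2.right_of_append
  simp only [List.isChain_cons_cons] at h32
  simp only [List.nodup_append, List.nodup_cons, List.mem_append, List.mem_cons, List.not_mem_nil,
    or_false] at hnd
  obtain ⟨c₁, hc₁, he₁⟩ := hc₀.exists_union_path hdeg u B.reverse (by simpa using hch4)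
    (by simp [List.nodup_append]; grind) (by simp; grind)
  obtain ⟨c₂, hc₂⟩ := hc₁.exists_union_path_insert hdeg (z := v₂) (a := v₁) (b := v₃)
    (L := A ++ [u])
    (by
      rw [List.append_assoc]
      exact List.isChain_split.2 ⟨hch1.1, by simpa using h2u.symm⟩)
    (by simp [List.nodup_append]; grind) (by simp; grind) (by simp) (by simp) (by grind)
    (by rw [he₁ _ (by simp), he₁ _ (by simp)])
    h32.2.1 h32.1.symm
  refine ⟨c₂, hc₂.mono fun v hv => ?_⟩
  have := hS v hv
  simp only [List.mem_append, List.mem_cons, List.not_mem_nil, or_false] at this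
  simp only [Finset.mem_insert, Finset.mem_union, Finset.mem_singleton, List.mem_toFinset,
    List.mem_append, List.mem_reverse, List.mem_cons, List.not_mem_nil, or_false]
  tauto

/-- If `C` is the vertex list of a cycle in `S` whose first vertex has all its neighbors on the
cycle, while some other vertex does not, then a coloring of `S \ C` gives a coloring of `S`. -/
theorem IsProperOn.exists_of_cycle [Fintype V] {k : ℕ} (hdeg : ∀ v, G.degree v ≤ k)
    {h l : V} {C : List V} (hch : (h :: C).IsChain G.Adj) (hnd : (h :: C).Nodup)
    (hl : l ∈ (h :: C).getLast?) (hlh : G.Adj l h)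
    (hh : ∀ w ∈ S, G.Adj h w → w ∈ h :: C) {x w : V} (hx : x ∈ h :: C) (hw : w ∈ S)
    (hwC : w ∉ h :: C) (hxw : G.Adj x w) {c : V → Fin k}
    (hc : G.IsProperOn c (S \ (h :: C).toFinset)) :
    ∃ c' : V → Fin k, G.IsProperOn c' S := by
  have hxC : x ∈ C := by
    rcases List.mem_cons.1 hx with rfl | hx
    · exact absurd (hh w hw hxw) hwC
    · exact hx
  obtain ⟨A, y, x, B, e, hy, w, hw, hwC, hxw⟩ := List.exists_eq_append_switch
    (fun x => ∃ w ∈ S, w ∉ h :: C ∧ G.Adj x w) h C (by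
      rintro ⟨w, hw, hwC, hxw⟩
      exact hwC (hh w hw hxw)) ⟨x, hxC, w, hw, hwC, hxw⟩
  push Not at hy
  have hlB : l ∈ (x :: B).getLast? := by
    rw [e] at hl
    simpa [List.getLast?_append, List.getLast?_cons_cons] using hl
  rw [e] at hch hnd hwC hc hy
  have hch1 := List.isChain_append_cons_cons.1 hch
  obtain ⟨hA, hyx, hB⟩ := hch1
  have hwS : w ∈ S \ (A ++ y :: x :: B).toFinset := by simp [hw] at hwC ⊢; tauto
  have hyS : y ∉ S \ (A ++ y :: x :: B).toFinset := by simp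
  have hc₁ := hc.update hyS (a := c w) (fun u hu hyu => by
    rw [Finset.mem_sdiff, List.mem_toFinset] at hu
    exact absurd hyu (hy u hu.1 hu.2))
  have hwy : w ≠ y := ne_of_mem_of_not_mem hwS hyS
  obtain ⟨c₂, hc₂⟩ := hc₁.exists_union_path_insert hdeg (z := x) (a := w) (b := y)
    (L := A.reverse ++ B.reverse)
    (by
      rw [List.append_assoc, ← List.reverse_cons, List.isChain_append]
      refine ⟨List.isChain_reverse.2 (hA.left_of_append.imp fun a b h => h.symm),
        List.isChain_reverse.2 (hB.imp fun a b h => h.symm), fun a ha b hb => ?_⟩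
      rw [List.getLast?_reverse] at ha
      rw [List.head?_reverse] at hb
      rw [Option.mem_unique hb hlB]
      have : a = h := by
        cases A <;> simp_all
      rw [this]
      exact hlh.symm)
    (by simp [List.nodup_append] at hnd ⊢; grind) (by simp [List.nodup_append] at hnd ⊢; grind)
    (Finset.mem_insert_of_mem hwS) (by simp) hwy
    (by rw [Function.update_self, Function.update_of_ne hwy]) hxw hyx.symm
  refine ⟨c₂, hc₂.mono fun v hv => ?_⟩
  simp only [Finset.mem_insert, Finset.mem_union, Finset.mem_sdiff, List.mem_toFinset,
    List.mem_append, List.mem_reverse, List.mem_cons]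
  tauto

/-- Two proper colorings of disjoint sets without edges between them can be merged. -/
theorem IsProperOn.piecewise {α : Type*} {T : Finset V} {c d : V → α} (hc : G.IsProperOn c T)
    (hd : G.IsProperOn d (S \ T)) (h : ∀ x ∈ T, ∀ w ∈ S, G.Adj x w → w ∈ T) :
    G.IsProperOn (T.piecewise c d) S := by
  intro x hx y hy hxy
  by_cases hxT : x ∈ T
  · have hyT := h x hxT y hy hxy
    rw [Finset.piecewise_eq_of_mem _ _ _ hxT, Finset.piecewise_eq_of_mem _ _ _ hyT]
    exact hc x hxT y hyT hxy
  · have hyT : y ∉ T := fun hyT => hxT (h y hyT x hx hxy.symm)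
    rw [Finset.piecewise_eq_of_notMem _ _ _ hxT, Finset.piecewise_eq_of_notMem _ _ _ hyT]
    exact hd x (by simp [hx, hxT]) y (by simp [hy, hyT]) hxy

/-- **Brooks' theorem** for induced subgraphs. -/
theorem exists_isProperOn_of_cliqueFree [Fintype V] {k : ℕ} (hk : 3 ≤ k)
    (hdeg : ∀ v, G.degree v ≤ k) (hG : G.CliqueFree (k + 1)) (S : Finset V) :
    ∃ c : V → Fin k, G.IsProperOn c S := by
  induction S using Finset.strongInduction with
  | H S ih =>
  by_cases hlow : ∃ v ∈ S, (G.neighborFinset v ∩ S).card < k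
  · obtain ⟨v, hv, hlt⟩ := hlow
    obtain ⟨c, hc⟩ := ih _ (Finset.erase_ssubset hv)
    obtain ⟨c', hc', -⟩ := hc.exists_insert (Finset.notMem_erase v S)
      ((Finset.card_image_le.trans (Finset.card_le_card
        (Finset.inter_subset_inter_left (Finset.erase_subset v S)))).trans_lt hlt)
    exact ⟨c', by rwa [Finset.insert_erase hv] at hc'⟩
  push Not at hlow
  rcases S.eq_empty_or_nonempty with rfl | ⟨v₂, hv₂⟩
  · exact ⟨fun _ => ⟨0, by omega⟩, by simp [IsProperOn]⟩
  obtain ⟨v₁, hv₁, v₃, hv₃, hne, h13⟩ : ∃ v₁ ∈ G.neighborFinset v₂ ∩ S,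
      ∃ v₃ ∈ G.neighborFinset v₂ ∩ S, v₁ ≠ v₃ ∧ ¬ G.Adj v₁ v₃ := by
    by_contra! hcl
    obtain ⟨T, hT, hTk⟩ := Finset.exists_subset_card_eq (hlow v₂ hv₂)
    refine hG (insert v₂ T) (IsNClique.insert ⟨fun x hx y hy hxy => ?_, hTk⟩ fun b hb => ?_)
    · exact hcl x (hT hx) y (hT hy) hxy
    · simpa using (Finset.mem_inter.1 (hT hb)).1
  rw [Finset.mem_inter, mem_neighborFinset] at hv₁ hv₃
  obtain ⟨Q, hch, hnd, hQS, hmax⟩ := exists_maximal_path (G := G) S [v₃, v₂, v₁]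
    (by simp [hv₁.1, hv₃.1.symm])
    (by have := hv₁.1.ne; have := hv₃.1.ne; grind) (by simp [hv₁.2, hv₂, hv₃.2])
  by_cases hspan : ∀ v ∈ S, v ∈ Q ++ [v₃, v₂, v₁]
  · obtain ⟨u, hu, hu'⟩ : ∃ u ∈ G.neighborFinset v₂ ∩ S, u ∉ ({v₁, v₃} : Finset V) :=
      Finset.exists_mem_notMem_of_card_lt_card
        (Finset.card_le_two.trans_lt (by have := hlow v₂ hv₂; omega))
    rw [Finset.mem_inter, mem_neighborFinset] at hu
    refine exists_isProperOn_of_spanning_path hdeg (by omega) hch hnd hspan h13 ?_ hu.1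
    have := hspan u hu.2
    have := hu.1.ne
    grind
  · push Not at hspan
    obtain ⟨s, hs, hsP⟩ := hspan
    obtain ⟨h, P, hP⟩ : ∃ h P, Q ++ [v₃, v₂, v₁] = h :: P := by
      cases Q <;> simp
    rw [hP] at hch hnd hQS hmax hsP
    have hmax := hmax h (by simp)
    have hhS := hQS h (by simp)
    obtain ⟨A, l, B, rfl, hl, hB⟩ := List.exists_eq_append_last (fun x => G.Adj h x) P (by
      obtain ⟨w, hw⟩ : (G.neighborFinset h ∩ S).Nonempty :=
        Finset.card_pos.1 (by have := hlow h hhS; omega)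
      rw [Finset.mem_inter, mem_neighborFinset] at hw
      have := hmax w hw.2 hw.1
      exact ⟨w, (List.mem_cons.1 this).resolve_left hw.1.ne', hw.1⟩)
    have hsplit : h :: (A ++ l :: B) = (h :: (A ++ [l])) ++ B := by simp
    have hCS : (h :: (A ++ [l])).toFinset ⊂ S := by
      refine (Finset.ssubset_iff_of_subset fun v hv => hQS v ?_).2 ⟨s, hs, ?_⟩
      · rw [hsplit]; exact List.mem_append_left _ (List.mem_toFinset.1 hv)
      · rw [hsplit] at hsP
        exact fun hv => hsP (List.mem_append_left _ (List.mem_toFinset.1 hv))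
    have hh : ∀ w ∈ S, G.Adj h w → w ∈ h :: (A ++ [l]) := by
      intro w hw hhw
      have := hmax w hw hhw
      rw [hsplit, List.mem_append] at this
      exact this.resolve_right fun hwB => hB w hwB hhw
    obtain ⟨d, hd⟩ := ih (S \ (h :: (A ++ [l])).toFinset)
      (Finset.sdiff_ssubset hCS.subset ⟨h, by simp⟩)
    by_cases hout : ∃ x ∈ h :: (A ++ [l]), ∃ w ∈ S, w ∉ h :: (A ++ [l]) ∧ G.Adj x w
    · obtain ⟨x, hx, w, hw, hwC, hxw⟩ := hout
      rw [hsplit] at hch hnd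
      exact hd.exists_of_cycle hdeg hch.left_of_append hnd.of_append_left
        (by rw [← List.cons_append, List.getLast?_append]; simp) hl.symm hh hx hw hwC hxw
    · push Not at hout
      obtain ⟨c, hc⟩ := ih _ hCS
      refine ⟨_, hc.piecewise hd fun x hx w hw hxw => ?_⟩
      rw [List.mem_toFinset] at hx ⊢
      by_contra hwC
      exact hout x hx w hw hwC hxw

end SimpleGraph

section MaxCut

variable {V : Type*}

theorem sgnCross_mk (X : Set V) (a b : V) :
    sgnCross X s(a, b) = true ↔ ¬ (a ∈ X ↔ b ∈ X) := by
  by_cases ha : a ∈ X <;> by_cases hb : b ∈ X <;> simp [sgnCross, ha, hb]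

/-- A 2-edge-connected cubic graph on more than four vertices has no `K₄`. -/
theorem TwoEdgeConn.cliqueFree_four [Fintype V] {G : SimpleGraph V} (h2ec : TwoEdgeConn G)
    (hcubic : ∀ v : V, G.degree v = 3) (hcard : 4 < Fintype.card V) : G.CliqueFree 4 := by
  intro T hT
  have hclosed : ∀ x ∈ T, ∀ w, G.Adj x w → w ∈ T := by
    intro x hx w hxw
    have hsub : T.erase x ⊆ G.neighborFinset x := fun y hy => by
      rw [Finset.mem_erase] at hy
      exact (G.mem_neighborFinset x y).2 (hT.isClique hx hy.2 hy.1.symm)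
    have heq := Finset.eq_of_subset_of_card_le hsub
      (by rw [G.card_neighborFinset_eq_degree, hcubic, Finset.card_erase_of_mem hx, hT.card_eq])
    exact Finset.mem_of_mem_erase (heq ▸ (G.mem_neighborFinset x w).2 hxw)
  have hpos : (T : Set V).Nonempty := Finset.card_pos.1 (by rw [hT.card_eq]; norm_num)
  have hcompl : (T : Set V)ᶜ.Nonempty := by
    obtain ⟨x, -, hx⟩ := Finset.exists_mem_notMem_of_card_lt_card
      (s := T) (t := Finset.univ) (by rwa [hT.card_eq])
    exact ⟨x, by simpa using hx⟩
  have hcut := h2ec T hpos hcompl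
  have hzero : {e | e ∈ G.edgeSet ∧ sgnCross (T : Set V) e = true} = ∅ := by
    refine Set.eq_empty_of_forall_notMem fun e => ?_
    induction e with
    | h a b =>
      rintro ⟨hab, hcross⟩
      rw [SimpleGraph.mem_edgeSet] at hab
      rw [sgnCross_mk] at hcross
      exact hcross ⟨fun ha => hclosed a ha b hab, fun hb => hclosed b hb a hab.symm⟩
  rw [cutSize, hzero, Set.ncard_empty] at hcut
  omega

/-- In a properly 3-colored graph of maximum degree at most 3, all but at most as many edges as
there are vertices of a given color can be cut. -/
theorem exists_edgeSet_ncard_le_cutSize_add [Fintype V] {G : SimpleGraph V}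
    (hdeg : ∀ v : V, G.degree v ≤ 3) {c : V → Fin 3} (hc : ∀ u v, G.Adj u v → c u ≠ c v)
    (i : Fin 3) :
    ∃ X : Set V, G.edgeSet.ncard ≤ cutSize G X + (Finset.univ.filter fun v => c v = i).card := by
  obtain ⟨p, q, hpi, hqi, hpq, hall⟩ : ∃ p q : Fin 3, p ≠ i ∧ q ≠ i ∧ p ≠ q ∧
      ∀ j, j ≠ i → j = p ∨ j = q := by
    revert i; decide
  let N (v : V) (j : Fin 3) : Finset V := (G.neighborFinset v).filter fun w => c w = j
  let X : Set V := {v | c v = p ∨ c v = i ∧ (N v p).card ≤ 1}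
  have hN (v : V) : (N v p).card + (N v q).card ≤ 3 := by
    rw [← Finset.card_union_of_disjoint
      (Finset.disjoint_filter.2 fun w _ h h' => hpq (h.symm.trans h'))]
    exact (Finset.card_le_card (Finset.union_subset (Finset.filter_subset _ _)
      (Finset.filter_subset _ _))).trans (hdeg v)
  have hpX {w : V} (hw : c w = p) : w ∈ X := Or.inl hw
  have hqX {w : V} (hw : c w = q) : w ∉ X := by
    rintro (h | h)
    · exact hpq (h.symm.trans hw)
    · exact hqi (hw.symm.trans h.1)
  let U (v : V) : Finset V := (G.neighborFinset v).filter fun w => (v ∈ X ↔ w ∈ X)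
  have hU {v : V} (hv : c v = i) : (U v).card ≤ 1 := by
    by_cases hvp : (N v p).card ≤ 1
    · refine (Finset.card_le_card fun w hw => ?_).trans hvp
      obtain ⟨hvw, hX⟩ := Finset.mem_filter.1 hw
      have hwX : w ∈ X := hX.1 (Or.inr ⟨hv, hvp⟩)
      refine Finset.mem_filter.2 ⟨hvw, hwX.resolve_right fun h => ?_⟩
      exact hc v w ((G.mem_neighborFinset v w).1 hvw) (hv.trans h.1.symm)
    · have hvq : (N v q).card ≤ 1 := by have := hN v; omega
      refine (Finset.card_le_card fun w hw => ?_).trans hvq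
      obtain ⟨hvw, hX⟩ := Finset.mem_filter.1 hw
      have hvX : v ∉ X := by
        rintro (h | h)
        · exact hpi (h.symm.trans hv)
        · exact hvp h.2
      have hwi : c w ≠ i := fun h =>
        hc v w ((G.mem_neighborFinset v w).1 hvw) (hv.trans h.symm)
      exact Finset.mem_filter.2 ⟨hvw, (hall _ hwi).resolve_left fun h => hvX (hX.2 (hpX h))⟩
  refine ⟨X, ?_⟩
  let uncut : Finset (Sym2 V) :=
    (Finset.univ.filter fun v => c v = i).biUnion fun v => (U v).image fun w => s(v, w)
  have huncut : uncut.card ≤ (Finset.univ.filter fun v => c v = i).card := by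
    refine (Finset.card_biUnion_le_card_mul _ _ 1 fun v hv => ?_).trans (by rw [mul_one])
    exact Finset.card_image_le.trans (hU (Finset.mem_filter.1 hv).2)
  have hcover : G.edgeSet ⊆ {e | e ∈ G.edgeSet ∧ sgnCross X e = true} ∪ uncut := by
    intro e
    induction e with
    | h a b =>
      intro hab
      by_cases hcross : sgnCross X s(a, b) = true
      · exact Or.inl ⟨hab, hcross⟩
      rw [SimpleGraph.mem_edgeSet] at hab
      rw [sgnCross_mk, not_not] at hcross
      have key {a b : V} (hab : G.Adj a b) (hX : a ∈ X ↔ b ∈ X) (ha : c a = i) :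
          s(a, b) ∈ uncut :=
        Finset.mem_biUnion.2 ⟨a, by simp [ha], Finset.mem_image.2
          ⟨b, Finset.mem_filter.2 ⟨(G.mem_neighborFinset a b).2 hab, hX⟩, rfl⟩⟩
      right
      by_cases ha : c a = i
      · exact key hab hcross ha
      by_cases hb : c b = i
      · rw [Sym2.eq_swap]
        exact key hab.symm hcross.symm hb
      exfalso
      have hne := hc a b hab
      rcases hall _ ha with ha | ha <;> rcases hall _ hb with hb | hb
      · exact hne (ha.trans hb.symm)
      · exact hqX hb (hcross.1 (hpX ha))
      · exact hqX ha (hcross.2 (hpX hb))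
      · exact hne (ha.trans hb.symm)
  calc G.edgeSet.ncard
      ≤ ({e | e ∈ G.edgeSet ∧ sgnCross X e = true} ∪ (uncut : Set (Sym2 V))).ncard :=
        Set.ncard_le_ncard hcover (Set.toFinite _)
    _ ≤ cutSize G X + (uncut : Set (Sym2 V)).ncard := Set.ncard_union_le _ _
    _ ≤ _ := by rw [Set.ncard_coe_finset]; gcongr

end MaxCut

/-- Every 2-edge-connected simple cubic graph on at least 10 vertices
has an edge-cut of size at least `(7/9)·e(G)`. -/
theorem exists_large_cut_of_cubic {V : Type*} [Fintype V]
    (G : SimpleGraph V)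
    (h2ec : TwoEdgeConn G)
    (hcubic : ∀ v : V, (G.neighborSet v).ncard = 3)
    (hcard : 10 ≤ Fintype.card V) :
    ∃ X : Set V, 7 * G.edgeSet.ncard ≤ 9 * cutSize G X := by
  have hdeg : ∀ v, G.degree v = 3 := fun v => by
    rw [← hcubic v, ← SimpleGraph.card_neighborSet_eq_degree, Set.ncard_eq_toFinset_card',
      Set.toFinset_card]
  obtain ⟨c, hc⟩ := SimpleGraph.exists_isProperOn_of_cliqueFree le_rfl (fun v => (hdeg v).le)
    (h2ec.cliqueFree_four hdeg (by omega)) Finset.univ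
  obtain ⟨i, -, hi⟩ := Finset.exists_min_image Finset.univ
    (fun i : Fin 3 => (Finset.univ.filter fun v => c v = i).card) Finset.univ_nonempty
  obtain ⟨X, hX⟩ := exists_edgeSet_ncard_le_cutSize_add (fun v => (hdeg v).le)
    (fun u v => hc u (Finset.mem_univ u) v (Finset.mem_univ v)) i
  have hsmall : 3 * (Finset.univ.filter fun v => c v = i).card ≤ Fintype.card V := by
    have hsum := Finset.card_eq_sum_card_fiberwise (f := c) (s := Finset.univ) (t := Finset.univ)
      (by simp)
    rw [← Finset.card_univ, hsum]
    simpa using Finset.card_nsmul_le_sum Finset.univ _ _ hi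
  have hedges : 2 * G.edgeSet.ncard = 3 * Fintype.card V := by
    have := G.sum_degrees_eq_twice_card_edges
    rw [Finset.sum_congr rfl fun v _ => hdeg v, Finset.sum_const, Finset.card_univ,
      smul_eq_mul] at this
    rw [← SimpleGraph.coe_edgeFinset, Set.ncard_coe_finset]
    omega
  exact ⟨X, by omega⟩
end
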